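/- There exist an absolute constant c' > 0 and n₀ ∈ ℕ such that for all n ≥ n₀ the following holds. Let K ⊆ ℝⁿ be a centrally symmetric convex set with |vol(K) − 1/2| ≤ (1/40) · n^{−1/2}. Let h_{1/2} : ℝⁿ → {−1,1} be defined by h_{1/2}(x) = 1 if ‖x‖₂ ≤ r_median and h_{1/2}(x) = −1 otherwise. Then Pr_{g ∼ N(0,1)ⁿ}[h_{1/2}(g) = K(g)] ≥ 1/2 + c'/√n. -/

import Mathlib

open MeasureTheory ProbabilityTheory

/-- The standard Gaussian measure `N(0,1)ⁿ` on `ℝⁿ`. -/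
noncomputable def stdGaussian (n : ℕ) : Measure (EuclideanSpace ℝ (Fin n)) :=
  (Measure.pi fun _ : Fin n => gaussianReal 0 1).map
    (EuclideanSpace.equiv (Fin n) ℝ).symm

open Classical in
/-- The `±1`-valued function associated to a set `K`. -/
noncomputable def pmInd {n : ℕ} (K : Set (EuclideanSpace ℝ (Fin n)))
    (x : EuclideanSpace ℝ (Fin n)) : ℝ :=
  if x ∈ K then 1 else -1

/-- The Gaussian volume of `K ⊆ ℝⁿ`. -/
noncomputable def gaussVol (n : ℕ) (K : Set (EuclideanSpace ℝ (Fin n))) : ℝ :=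
  (stdGaussian n K).toReal

section Gaussian

variable {E : Type*} [NormedAddCommGroup E] [InnerProductSpace ℝ E]

/-- The density of the standard Gaussian measure. -/
noncomputable def gaussDensity (E : Type*) [NormedAddCommGroup E] [InnerProductSpace ℝ E] (x : E) :
    ℝ :=
  ((2 * Real.pi) ^ (Module.finrank ℝ E / 2 : ℝ))⁻¹ * Real.exp (-(1 / 2) * ‖x‖ ^ 2)

lemma gaussDensity_nonneg (x : E) : 0 ≤ gaussDensity E x := by
  unfold gaussDensity; positivity

variable [MeasurableSpace E] [BorelSpace E]

lemma measurable_gaussDensity : Measurable (gaussDensity E) := by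
  unfold gaussDensity; fun_prop

variable [FiniteDimensional ℝ E]

lemma integrable_rexp_neg_mul_sq_norm {b : ℝ} (hb : 0 < b) :
    Integrable (fun v : E => Real.exp (-b * ‖v‖ ^ 2)) := by
  have h := (GaussianFourier.integrable_cexp_neg_mul_sq_norm_add
    (show 0 < (b : ℂ).re from hb) 0 (0 : E)).norm
  refine h.congr (Filter.Eventually.of_forall fun v => ?_)
  simp only [zero_mul, add_zero]
  rw [show -(b : ℂ) * (‖v‖ : ℂ) ^ 2 = ((-b * ‖v‖ ^ 2 : ℝ) : ℂ) by push_cast; ring,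
    ← Complex.ofReal_exp, Complex.norm_real, Real.norm_of_nonneg (Real.exp_pos _).le]

lemma integrable_gaussDensity : Integrable (gaussDensity E) :=
  (integrable_rexp_neg_mul_sq_norm (by norm_num)).const_mul _

lemma stdGaussian_eq_withDensity :
    ProbabilityTheory.stdGaussian E =
      (volume : Measure E).withDensity fun x => ENNReal.ofReal (gaussDensity E x) := by
  have : IsFiniteMeasure
      ((volume : Measure E).withDensity fun x => ENNReal.ofReal (gaussDensity E x)) :=
    isFiniteMeasure_withDensity_ofReal integrable_gaussDensity.2
  apply Measure.ext_of_charFun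
  ext t
  rw [charFun_stdGaussian, charFun_apply,
    integral_withDensity_eq_integral_toReal_smul
      measurable_gaussDensity.ennreal_ofReal (by simp)]
  have h := GaussianFourier.integral_cexp_neg_mul_sq_norm_add
    (b := (1 / 2 : ℂ)) (by norm_num) Complex.I t
  have hc : ((2 * Real.pi : ℂ) ^ (Module.finrank ℝ E / 2 : ℂ)) =
      (((2 * Real.pi) ^ (Module.finrank ℝ E / 2 : ℝ) : ℝ) : ℂ) := by
    rw [Complex.ofReal_cpow (by positivity)]; push_cast; rfl
  have hne : ((2 * Real.pi) ^ (Module.finrank ℝ E / 2 : ℝ) : ℝ) ≠ 0 := by positivity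
  have e : ∀ x : E, (ENNReal.ofReal (gaussDensity E x)).toReal •
      Complex.exp (inner ℝ x t * Complex.I) =
      ((2 * Real.pi : ℂ) ^ (Module.finrank ℝ E / 2 : ℂ))⁻¹ *
        Complex.exp (-(1 / 2) * ‖x‖ ^ 2 + Complex.I * inner ℝ t x) := by
    intro x
    rw [ENNReal.toReal_ofReal (gaussDensity_nonneg x), gaussDensity, Complex.real_smul, hc,
      Complex.exp_add, real_inner_comm]
    push_cast
    ring_nf
  simp_rw [e]
  rw [integral_const_mul, h, show (Real.pi : ℂ) / (1 / 2) = 2 * Real.pi by ring, ← mul_assoc,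
    inv_mul_cancel₀, one_mul]
  · rw [Complex.I_sq]; ring_nf
  · rw [hc]; exact_mod_cast hne

lemma stdGaussian_absolutelyContinuous :
    ProbabilityTheory.stdGaussian E ≪ (volume : Measure E) := by
  rw [stdGaussian_eq_withDensity]
  exact withDensity_absolutelyContinuous _ _

/-- Under the standard Gaussian measure, the direction and the norm are independent. -/
lemma indepFun_direction_norm [Nontrivial E] :
    IndepFun (fun x : E => ‖x‖⁻¹ • x) (fun x : E => ‖x‖) (ProbabilityTheory.stdGaussian E) := by
  set γ := ProbabilityTheory.stdGaussian E with hγ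
  have mθ : Measurable fun x : E => ‖x‖⁻¹ • x := by fun_prop
  have mR : Measurable fun x : E => ‖x‖ := by fun_prop
  set σ := (volume : Measure E).toSphere
  set ρ := Measure.volumeIoiPow (Module.finrank ℝ E - 1)
  let c : ℝ → ENNReal := fun r =>
    ENNReal.ofReal (((2 * Real.pi) ^ (Module.finrank ℝ E / 2 : ℝ))⁻¹ *
      Real.exp (-(1 / 2) * r ^ 2))
  have mc : Measurable c := by unfold c; fun_prop
  have key : ∀ (S : Set E) (T : Set ℝ), MeasurableSet S → MeasurableSet T →
      γ ((fun x : E => ‖x‖⁻¹ • x) ⁻¹' S ∩ (fun x : E => ‖x‖) ⁻¹' T) =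
        σ (Subtype.val ⁻¹' S) * ∫⁻ r : Set.Ioi (0 : ℝ), T.indicator c r ∂ρ := by
    intro S T hS hT
    have hms := (mθ hS).inter (mR hT)
    rw [hγ, stdGaussian_eq_withDensity, withDensity_apply _ hms, ← lintegral_indicator hms,
      ← restrict_compl_singleton (μ := (volume : Measure E)) 0,
      ← lintegral_subtype_comap (measurableSet_singleton (0 : E)).compl]
    have hmp := (volume : Measure E).measurePreserving_homeomorphUnitSphereProd
    have mG : Measurable fun z : Metric.sphere (0 : E) 1 × Set.Ioi (0 : ℝ) =>
        (Subtype.val ⁻¹' S).indicator (1 : Metric.sphere (0 : E) 1 → ENNReal) z.1 *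
          T.indicator c z.2 :=
      ((measurable_one.indicator (measurable_subtype_coe hS)).comp measurable_fst).mul
        (((mc.indicator hT).comp measurable_subtype_coe).comp measurable_snd)
    have h2 := hmp.lintegral_comp mG
    rw [lintegral_prod_mul (g := fun r : Set.Ioi (0 : ℝ) => T.indicator c r)
      (measurable_one.indicator (measurable_subtype_coe hS)).aemeasurable
      ((mc.indicator hT).comp measurable_subtype_coe).aemeasurable,
      lintegral_indicator_one (measurable_subtype_coe hS)] at h2
    rw [← h2]
    refine lintegral_congr fun x => ?_
    by_cases h1 : ‖(x : E)‖⁻¹ • (x : E) ∈ S <;> by_cases h2 : ‖(x : E)‖ ∈ T <;>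
      simp [Set.indicator, h1, h2, c, gaussDensity]
  have kS : ∀ S : Set E, MeasurableSet S → γ ((fun x : E => ‖x‖⁻¹ • x) ⁻¹' S) =
      σ (Subtype.val ⁻¹' S) * ∫⁻ r : Set.Ioi (0 : ℝ), c r ∂ρ := by
    intro S hS
    simpa using key S Set.univ hS MeasurableSet.univ
  have kT : ∀ T : Set ℝ, MeasurableSet T → γ ((fun x : E => ‖x‖) ⁻¹' T) =
      σ Set.univ * ∫⁻ r : Set.Ioi (0 : ℝ), T.indicator c r ∂ρ := by
    intro T hT
    simpa using key Set.univ T MeasurableSet.univ hT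
  have k1 : σ Set.univ * ∫⁻ r : Set.Ioi (0 : ℝ), c r ∂ρ = 1 := by
    simpa using (kS Set.univ MeasurableSet.univ).symm
  rw [indepFun_iff_measure_inter_preimage_eq_mul]
  intro S T hS hT
  rw [key S T hS hT, kS S hS, kT T hT, mul_mul_mul_comm, mul_comm (σ _) (σ Set.univ),
    mul_mul_mul_comm, k1, one_mul]

lemma lintegral_direction_norm [Nontrivial E] {G : E × ℝ → ENNReal} (hG : Measurable G) :
    ∫⁻ x, G (‖x‖⁻¹ • x, ‖x‖) ∂ProbabilityTheory.stdGaussian E =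
      ∫⁻ x, ∫⁻ y, G (‖x‖⁻¹ • x, ‖y‖) ∂ProbabilityTheory.stdGaussian E
        ∂ProbabilityTheory.stdGaussian E := by
  set γ := ProbabilityTheory.stdGaussian E with hγ
  have mθ : Measurable fun x : E => ‖x‖⁻¹ • x := by fun_prop
  have mR : Measurable fun x : E => ‖x‖ := by fun_prop
  have h := (indepFun_iff_map_prod_eq_prod_map_map mθ.aemeasurable mR.aemeasurable).1
    (indepFun_direction_norm (E := E))
  rw [← lintegral_map hG (mθ.prodMk mR), h, lintegral_prod _ hG.aemeasurable,
    lintegral_map (f := fun z => ∫⁻ r, G (z, r) ∂Measure.map (fun x : E => ‖x‖) γ)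
      hG.lintegral_prod_right' mθ]
  refine lintegral_congr fun x => ?_
  exact lintegral_map (hG.comp measurable_prodMk_left) mR

end Gaussian

section Moments

variable {E : Type*} [NormedAddCommGroup E] [InnerProductSpace ℝ E] [FiniteDimensional ℝ E]
  [MeasurableSpace E] [BorelSpace E]

lemma lintegral_exp_neg_mul_sq_norm_stdGaussian {s : ℝ} (hs : 0 < s) :
    ∫⁻ x : E, ENNReal.ofReal (Real.exp (-s * ‖x‖ ^ 2)) ∂ProbabilityTheory.stdGaussian E =
      ENNReal.ofReal ((1 + 2 * s) ^ (-(Module.finrank ℝ E / 2 : ℝ))) := by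
  rw [stdGaussian_eq_withDensity,
    lintegral_withDensity_eq_lintegral_mul _ measurable_gaussDensity.ennreal_ofReal
      (by fun_prop)]
  have e : ∀ x : E, ((fun x : E => ENNReal.ofReal (gaussDensity E x)) *
      fun x : E => ENNReal.ofReal (Real.exp (-s * ‖x‖ ^ 2))) x =
      ENNReal.ofReal (((2 * Real.pi) ^ (Module.finrank ℝ E / 2 : ℝ))⁻¹ *
        Real.exp (-(s + 1 / 2) * ‖x‖ ^ 2)) := by
    intro x
    simp only [Pi.mul_apply]
    rw [← ENNReal.ofReal_mul (gaussDensity_nonneg x), gaussDensity, mul_assoc, ← Real.exp_add]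
    ring_nf
  rw [lintegral_congr e, ← ofReal_integral_eq_lintegral_ofReal
    ((integrable_rexp_neg_mul_sq_norm (by positivity)).const_mul _)
    (Filter.Eventually.of_forall fun x => by positivity),
    integral_const_mul, GaussianFourier.integral_rexp_neg_mul_sq_norm (by positivity),
    ← Real.inv_rpow (by positivity), ← Real.mul_rpow (by positivity) (by positivity),
    Real.rpow_neg (by positivity), ← Real.inv_rpow (by positivity)]
  congr 2
  have := Real.pi_pos
  field_simp
  ring

lemma lintegral_one_add_rpow {p : ℝ} (hp : 1 < p) :
    ∫⁻ s in Set.Ioi (0 : ℝ), ENNReal.ofReal ((1 + 2 * s) ^ (-p)) =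
      ENNReal.ofReal (1 / (2 * p - 2)) := by
  have hp' : 2 * p - 2 ≠ 0 := by linarith
  have hder : ∀ x ∈ Set.Ici (0 : ℝ),
      HasDerivAt (fun s : ℝ => -(1 / (2 * p - 2)) * (1 + 2 * s) ^ (1 - p))
        ((1 + 2 * x) ^ (-p)) x := by
    intro x hx
    have hx' : (0 : ℝ) < 1 + 2 * x := by have : (0 : ℝ) ≤ x := hx; linarith
    have h1 : HasDerivAt (fun s : ℝ => 1 + 2 * s) 2 x := by
      simpa using ((hasDerivAt_id x).const_mul 2).const_add 1
    have h2 := (h1.rpow_const (p := 1 - p) (Or.inl hx'.ne')).const_mul (-(1 / (2 * p - 2)))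
    have e : -(1 / (2 * p - 2)) * (2 * (1 - p) * (1 + 2 * x) ^ (1 - p - 1)) =
        (1 + 2 * x) ^ (-p) := by
      rw [show 1 - p - 1 = -p by ring, ← mul_assoc, show 2 * (1 - p) = -(2 * p - 2) by ring,
        neg_mul_neg, one_div, inv_mul_cancel₀ hp', one_mul]
    rwa [e] at h2
  have hlim : Filter.Tendsto (fun s : ℝ => -(1 / (2 * p - 2)) * (1 + 2 * s) ^ (1 - p))
      Filter.atTop (nhds 0) := by
    have h3 : Filter.Tendsto (fun s : ℝ => 1 + 2 * s) Filter.atTop Filter.atTop :=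
      Filter.tendsto_atTop_add_const_left _ _
        (Filter.tendsto_id.const_mul_atTop (by norm_num))
    have h4 := (tendsto_rpow_neg_atTop (y := p - 1) (by linarith)).comp h3
    have h5 := h4.const_mul (-(1 / (2 * p - 2)))
    simpa [Function.comp_def] using h5
  have hnn : ∀ x ∈ Set.Ioi (0 : ℝ), 0 ≤ (1 + 2 * x) ^ (-p) := fun x hx => by
    have : (0 : ℝ) < x := hx
    positivity
  rw [← ofReal_integral_eq_lintegral_ofReal
    (integrableOn_Ioi_deriv_of_nonneg' hder hnn hlim)
    ((ae_restrict_iff' measurableSet_Ioi).2 (Filter.Eventually.of_forall hnn)),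
    integral_Ioi_of_hasDerivAt_of_nonneg' hder hnn hlim]
  simp

lemma lintegral_inv_sq_norm (hE : 2 < Module.finrank ℝ E) :
    ∫⁻ x : E, ENNReal.ofReal ((‖x‖ ^ 2)⁻¹) ∂ProbabilityTheory.stdGaussian E =
      ENNReal.ofReal (1 / (Module.finrank ℝ E - 2)) := by
  have : Nontrivial E := Module.nontrivial_of_finrank_pos (R := ℝ) (by omega)
  have hE' : (2 : ℝ) < Module.finrank ℝ E := by exact_mod_cast hE
  have h1 : ∀ᵐ x ∂ProbabilityTheory.stdGaussian E, ENNReal.ofReal ((‖x‖ ^ 2)⁻¹) =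
      ∫⁻ s in Set.Ioi (0 : ℝ), ENNReal.ofReal (Real.exp (-s * ‖x‖ ^ 2)) := by
    have h0 : ∀ᵐ x ∂(volume : Measure E), x ≠ 0 := by
      simp [ae_iff]
    filter_upwards [stdGaussian_absolutelyContinuous.ae_le h0] with x hx
    have hx2 : 0 < ‖x‖ ^ 2 := by positivity
    have e : ∀ s : ℝ, Real.exp (-s * ‖x‖ ^ 2) = Real.exp (-‖x‖ ^ 2 * s) := fun s => by ring_nf
    simp_rw [e]
    rw [← ofReal_integral_eq_lintegral_ofReal (integrableOn_exp_mul_Ioi (by linarith) 0)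
      (Filter.Eventually.of_forall fun s => (Real.exp_pos _).le),
      integral_exp_mul_Ioi (by linarith)]
    simp
  rw [lintegral_congr_ae h1, lintegral_lintegral_swap (by fun_prop),
    setLIntegral_congr_fun measurableSet_Ioi
      (fun s hs => lintegral_exp_neg_mul_sq_norm_stdGaussian (E := E) hs),
    lintegral_one_add_rpow (by linarith)]
  congr 2
  ring

lemma integrable_inv_sq_norm (hE : 2 < Module.finrank ℝ E) :
    Integrable (fun x : E => (‖x‖ ^ 2)⁻¹) (ProbabilityTheory.stdGaussian E) := by
  refine (lintegral_ofReal_ne_top_iff_integrable (by fun_prop)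
    (Filter.Eventually.of_forall fun x => by positivity)).1 ?_
  rw [lintegral_inv_sq_norm hE]
  exact ENNReal.ofReal_ne_top

lemma integral_inv_sq_norm (hE : 2 < Module.finrank ℝ E) :
    ∫ x : E, (‖x‖ ^ 2)⁻¹ ∂ProbabilityTheory.stdGaussian E = 1 / (Module.finrank ℝ E - 2) := by
  have hE' : (2 : ℝ) < Module.finrank ℝ E := by exact_mod_cast hE
  rw [integral_eq_lintegral_of_nonneg_ae (Filter.Eventually.of_forall fun x => by positivity)
    (by fun_prop), lintegral_inv_sq_norm hE, ENNReal.toReal_ofReal]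
  exact one_div_nonneg.2 (by linarith)

/-- The first absolute moment is at most the root of the second moment. -/
lemma integral_abs_le_sqrt {Ω : Type*} [MeasurableSpace Ω] {P : Measure Ω} [IsProbabilityMeasure P]
    {f : Ω → ℝ} (hf : MemLp f 2 P) : ∫ x, |f x| ∂P ≤ √(∫ x, f x ^ 2 ∂P) := by
  apply Real.le_sqrt_of_sq_le
  have h := variance_nonneg |f| P
  rw [variance_eq_sub hf.abs] at h
  simpa using h

lemma memLp_inv_norm (hE : 2 < Module.finrank ℝ E) :
    MemLp (fun x : E => ‖x‖⁻¹) 2 (ProbabilityTheory.stdGaussian E) := by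
  rw [memLp_two_iff_integrable_sq (by fun_prop)]
  simpa using integrable_inv_sq_norm hE

lemma integral_inv_norm_le (hE : 2 < Module.finrank ℝ E) :
    ∫ x : E, ‖x‖⁻¹ ∂ProbabilityTheory.stdGaussian E ≤ √(1 / (Module.finrank ℝ E - 2)) := by
  have h := integral_abs_le_sqrt (memLp_inv_norm hE)
  simpa [integral_inv_sq_norm hE] using h

lemma memLp_inner_stdGaussian (v : E) :
    MemLp (fun y : E => inner ℝ v y) 2 (ProbabilityTheory.stdGaussian E) :=
  (IsGaussian.memLp_dual (ProbabilityTheory.stdGaussian E) (innerSL ℝ v) 2 (by simp))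

lemma integral_inner_sq_stdGaussian (v : E) :
    ∫ y, inner ℝ v y ^ 2 ∂ProbabilityTheory.stdGaussian E = ‖v‖ ^ 2 := by
  have h := variance_dual_stdGaussian (innerSL ℝ v)
  rw [variance_eq_sub (X := innerSL ℝ v) (memLp_inner_stdGaussian v),
    integral_strongDual_stdGaussian] at h
  simpa using h

lemma integral_abs_inner_le (v : E) :
    ∫ y, |inner ℝ v y| ∂ProbabilityTheory.stdGaussian E ≤ ‖v‖ := by
  have h := integral_abs_le_sqrt (memLp_inner_stdGaussian v)
  rwa [integral_inner_sq_stdGaussian, Real.sqrt_sq (norm_nonneg v)] at h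

lemma integrable_sq_norm_stdGaussian :
    Integrable (fun y : E => ‖y‖ ^ 2) (ProbabilityTheory.stdGaussian E) := by
  have h : MemLp (fun y : E => y) 2 (ProbabilityTheory.stdGaussian E) :=
    IsGaussian.memLp_two_id
  exact h.integrable_norm_pow (by norm_num)

lemma integral_sq_norm_stdGaussian :
    ∫ y : E, ‖y‖ ^ 2 ∂ProbabilityTheory.stdGaussian E = Module.finrank ℝ E := by
  have e : ∀ y : E, ‖y‖ ^ 2 = ∑ i, inner ℝ (stdOrthonormalBasis ℝ E i) y ^ 2 := fun y => by
    rw [OrthonormalBasis.sum_sq_inner_right]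
  simp_rw [e]
  rw [integral_finsetSum _ fun i _ => (memLp_inner_stdGaussian _).integrable_sq]
  simp [integral_inner_sq_stdGaussian]

end Moments

section Crossing

variable {E : Type*} [NormedAddCommGroup E] [InnerProductSpace ℝ E] [FiniteDimensional ℝ E]
  [MeasurableSpace E] [BorelSpace E]

lemma measurePreserving_rotation_stdGaussian (θ : ℝ) :
    MeasurePreserving (ContinuousLinearMap.rotation (E := E) θ)
      ((ProbabilityTheory.stdGaussian E).prod (ProbabilityTheory.stdGaussian E))
      ((ProbabilityTheory.stdGaussian E).prod (ProbabilityTheory.stdGaussian E)) :=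
  ⟨by fun_prop, IsGaussian.map_rotation_eq_self (by simp) θ⟩

/-- A quarter turn from `x` to an independent copy `y`, cut into `N` steps of equal law. -/
lemma integral_abs_sub_le_nat_mul {f : E → ℝ} (hf : Measurable f) (h0 : ∀ x, 0 ≤ f x)
    (h1 : ∀ x, f x ≤ 1) {N : ℕ} (hN : N ≠ 0) :
    ∫ z, |f z.1 - f z.2| ∂(ProbabilityTheory.stdGaussian E).prod
        (ProbabilityTheory.stdGaussian E) ≤
      N * ∫ z, |f z.1 - f (Real.cos (Real.pi / (2 * N)) • z.1 +
        Real.sin (Real.pi / (2 * N)) • z.2)| ∂(ProbabilityTheory.stdGaussian E).prod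
          (ProbabilityTheory.stdGaussian E) := by
  set γ₂ := (ProbabilityTheory.stdGaussian E).prod (ProbabilityTheory.stdGaussian E)
  set τ := Real.pi / (2 * N) with hτ
  have hbd : ∀ x y, ‖|f x - f y|‖ ≤ 1 := fun x y => by
    rw [Real.norm_eq_abs, abs_abs, abs_le]
    constructor <;> linarith [h0 x, h0 y, h1 x, h1 y]
  have hint : ∀ g h : E × E → E, Measurable g → Measurable h →
      Integrable (fun z => |f (g z) - f (h z)|) γ₂ := fun g h hg hh =>
    .of_bound (by fun_prop) 1 (Filter.Eventually.of_forall fun z => hbd _ _)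
  let X : ℕ → E × E → E := fun j z => (ContinuousLinearMap.rotation (j * τ) z).1
  have mX : ∀ j, Measurable (X j) := fun j => by unfold X; fun_prop
  have hX0 : ∀ z, X 0 z = z.1 := fun z => by
    simp [X, ContinuousLinearMap.rotation_apply]
  have hXN : ∀ z, X N z = z.2 := fun z => by
    have : (N : ℝ) * τ = Real.pi / 2 := by rw [hτ]; field_simp
    simp [X, ContinuousLinearMap.rotation_apply, this]
  have hstep : ∀ j z, X (j + 1) z =
      Real.cos τ • (ContinuousLinearMap.rotation (j * τ) z).1 +
        Real.sin τ • (ContinuousLinearMap.rotation (j * τ) z).2 := by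
    intro j z
    simp only [X, ContinuousLinearMap.rotation_apply]
    have : ((j + 1 : ℕ) : ℝ) * τ = j * τ + τ := by push_cast; ring
    rw [this, Real.cos_add, Real.sin_add]
    module
  calc ∫ z, |f z.1 - f z.2| ∂γ₂
      ≤ ∫ z, ∑ j ∈ Finset.range N, |f (X j z) - f (X (j + 1) z)| ∂γ₂ := by
        refine integral_mono (hint _ _ measurable_fst measurable_snd)
          (integrable_finsetSum _ fun j _ => hint _ _ (mX j) (mX (j + 1))) fun z => ?_
        have := Finset.sum_range_sub' (fun j => f (X j z)) N
        simp only [hX0, hXN] at this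
        simp only [← this]
        exact Finset.abs_sum_le_sum_abs _ _
    _ = ∑ j ∈ Finset.range N, ∫ z, |f (X j z) - f (X (j + 1) z)| ∂γ₂ :=
        integral_finsetSum _ fun j _ => hint _ _ (mX j) (mX (j + 1))
    _ = ∑ j ∈ Finset.range N, ∫ z, |f z.1 - f (Real.cos τ • z.1 + Real.sin τ • z.2)| ∂γ₂ := by
        refine Finset.sum_congr rfl fun j _ => ?_
        have h : MeasurePreserving (ContinuousLinearMap.rotation (E := E) (j * τ)) γ₂ γ₂ :=
          measurePreserving_rotation_stdGaussian _
        conv_rhs => rw [← h.map_eq]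
        rw [integral_map h.measurable.aemeasurable (by fun_prop)]
        simp only [hstep, X]
    _ = _ := by simp

lemma integral_abs_sub_rotation_eq {f : E → ℝ} (hf : Measurable f) (h0 : ∀ x, 0 ≤ f x)
    (h1 : ∀ x, f x ≤ 1) (τ : ℝ) :
    ∫ z, |f z.1 - f (Real.cos τ • z.1 + Real.sin τ • z.2)|
        ∂(ProbabilityTheory.stdGaussian E).prod (ProbabilityTheory.stdGaussian E) =
      2 * ∫ z, max (f (Real.cos τ • z.1 + Real.sin τ • z.2) - f z.1) 0
        ∂(ProbabilityTheory.stdGaussian E).prod (ProbabilityTheory.stdGaussian E) := by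
  set γ₂ := (ProbabilityTheory.stdGaussian E).prod (ProbabilityTheory.stdGaussian E)
  have hint : ∀ g : E × E → E, Measurable g → Integrable (fun z => f (g z)) γ₂ := fun g hg =>
    .of_bound (hf.comp hg).aestronglyMeasurable 1 (Filter.Eventually.of_forall fun z => by
      rw [Real.norm_of_nonneg (h0 _)]; exact h1 _)
  have i1 := hint (fun z => z.1) measurable_fst
  have i2 := hint (fun z => Real.cos τ • z.1 + Real.sin τ • z.2) (by fun_prop)
  have i3 : Integrable
      (fun z => f (Real.cos τ • z.1 + Real.sin τ • z.2) - f z.1) γ₂ := i2.sub i1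
  have hmean : ∫ z, f (Real.cos τ • z.1 + Real.sin τ • z.2) ∂γ₂ = ∫ z, f z.1 ∂γ₂ := by
    have h : MeasurePreserving (ContinuousLinearMap.rotation (E := E) τ) γ₂ γ₂ :=
      measurePreserving_rotation_stdGaussian _
    conv_rhs => rw [← h.map_eq]
    exact (integral_map h.measurable.aemeasurable
      (hf.comp measurable_fst).aestronglyMeasurable).symm
  have e : ∀ a b : ℝ, |a - b| = 2 * max (b - a) 0 - (b - a) := fun a b => by
    rcases le_total a b with h | h
    · rw [max_eq_left (by linarith), abs_of_nonpos (by linarith)]; ring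
    · rw [max_eq_right (by linarith), abs_of_nonneg (by linarith)]; ring
  simp_rw [e]
  rw [integral_sub (i3.pos_part.const_mul 2) i3, integral_const_mul,
    integral_sub i2 i1, hmean]
  ring

end Crossing

section Cone

variable {E : Type*} [NormedAddCommGroup E] [InnerProductSpace ℝ E]

lemma Seminorm.continuous_of_le_mul_norm {p : Seminorm ℝ E} {M : ℝ} (hM : 0 ≤ M)
    (hp : ∀ z, p z ≤ M * ‖z‖) : Continuous p := by
  refine (LipschitzWith.of_dist_le_mul (K := ⟨M, hM⟩) fun x y => ?_).continuous
  rw [Real.dist_eq, dist_eq_norm]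
  exact (abs_sub_map_le_sub p x y).trans (hp _)

/-- A seminorm on a finite-dimensional space has a subgradient at every point. -/
lemma Seminorm.exists_subgradient [FiniteDimensional ℝ E] (p : Seminorm ℝ E) (x : E) :
    ∃ u : E, inner ℝ u x = p x ∧ ∀ z, inner ℝ u z ≤ p z := by
  rcases eq_or_ne x 0 with rfl | hx
  · exact ⟨0, by simp⟩
  obtain ⟨g, hg, hgp⟩ := exists_extension_of_le_sublinear
    (LinearPMap.mkSpanSingleton (K := ℝ) x (p x) hx) p
    (fun c hc z => by rw [map_smul_eq_mul, Real.norm_of_nonneg hc.le])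
    (fun y z => map_add_le_add p y z) (by
      rintro ⟨z, hz⟩
      obtain ⟨c, rfl⟩ := Submodule.mem_span_singleton.1 hz
      rw [LinearPMap.mkSpanSingleton'_apply, map_smul_eq_mul]
      exact mul_le_mul_of_nonneg_right (Real.le_norm_self c) (apply_nonneg p x))
  refine ⟨(InnerProductSpace.toDual ℝ E).symm (LinearMap.toContinuousLinearMap g), ?_, fun z => ?_⟩
  · rw [InnerProductSpace.toDual_symm_apply, LinearMap.coe_toContinuousLinearMap']
    have := hg ⟨x, Submodule.mem_span_singleton_self x⟩
    rw [this, LinearPMap.mkSpanSingleton_apply]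
  · rw [InnerProductSpace.toDual_symm_apply, LinearMap.coe_toContinuousLinearMap']
    exact hgp z

lemma inv_norm_mul_sub_le {p : Seminorm ℝ E} {M : ℝ} (hp : ∀ z, p z ≤ M * ‖z‖) {x u : E}
    (hx : x ≠ 0) (hux : inner ℝ u x = p x) (hu : ∀ z, inner ℝ u z ≤ p z) {ε : ℝ} (hε : 0 ≤ ε)
    (hM : 0 ≤ M) (y : E) :
    ‖x‖⁻¹ * p x - ‖x + ε • y‖⁻¹ * p (x + ε • y) ≤
      ‖x‖⁻¹ * (ε * (|inner ℝ u y| + M * |inner ℝ (‖x‖⁻¹ • x) y|)) +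
        ε ^ 2 * M / 2 * ‖y‖ ^ 2 * (‖x‖ ^ 2)⁻¹ := by
  have hx' : 0 < ‖x‖ := norm_pos_iff.2 hx
  set z := x + ε • y with hz
  have hqz : ‖z‖⁻¹ * p z * ‖z‖ = p z := by
    rcases eq_or_ne z 0 with h | h
    · simp [h]
    · field_simp
  have hq0 : 0 ≤ ‖z‖⁻¹ * p z := by positivity
  have hqM : ‖z‖⁻¹ * p z ≤ M := by
    rcases eq_or_ne z 0 with h | h
    · simpa [h] using hM
    · rw [inv_mul_le_iff₀ (norm_pos_iff.2 h), mul_comm]; exact hp z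
  set Q := ‖z‖⁻¹ * p z
  have h1 : p x - p z ≤ ε * |inner ℝ u y| := by
    have := hu z
    rw [hz, inner_add_right, inner_smul_right, hux] at this
    nlinarith [neg_abs_le (inner ℝ u y)]
  have h2 : ‖z‖ - ‖x‖ ≤ ε * |inner ℝ (‖x‖⁻¹ • x) y| + ε ^ 2 * ‖y‖ ^ 2 / (2 * ‖x‖) := by
    have e : ‖z‖ ^ 2 = ‖x‖ ^ 2 + 2 * (ε * inner ℝ x y) + ε ^ 2 * ‖y‖ ^ 2 := by
      rw [hz, norm_add_sq_real, inner_smul_right, norm_smul, mul_pow, Real.norm_eq_abs, sq_abs]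
    have h3 : ‖z‖ - ‖x‖ ≤ (‖z‖ ^ 2 - ‖x‖ ^ 2) / (2 * ‖x‖) := by
      rw [le_div_iff₀ (by positivity)]; nlinarith [sq_nonneg (‖z‖ - ‖x‖)]
    refine h3.trans ?_
    rw [e, real_inner_smul_left]
    have h4 : ‖x‖⁻¹ * inner ℝ x y ≤ |‖x‖⁻¹ * inner ℝ x y| := le_abs_self _
    have h5 := mul_le_mul_of_nonneg_left h4 hε
    calc _ = ε * (‖x‖⁻¹ * inner ℝ x y) + ε ^ 2 * ‖y‖ ^ 2 / (2 * ‖x‖) := by field_simp; ring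
      _ ≤ _ := by linarith
  have h6 : Q * (‖z‖ - ‖x‖) ≤
      M * (ε * |inner ℝ (‖x‖⁻¹ • x) y| + ε ^ 2 * ‖y‖ ^ 2 / (2 * ‖x‖)) :=
    (mul_le_mul_of_nonneg_left h2 hq0).trans (mul_le_mul_of_nonneg_right hqM (by positivity))
  have h7 : ‖x‖⁻¹ * p x - Q = ‖x‖⁻¹ * ((p x - p z) + Q * (‖z‖ - ‖x‖)) := by
    rw [mul_sub, hqz]; field_simp; ring
  rw [h7]
  calc _ ≤ ‖x‖⁻¹ * (ε * |inner ℝ u y| +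
        M * (ε * |inner ℝ (‖x‖⁻¹ • x) y| + ε ^ 2 * ‖y‖ ^ 2 / (2 * ‖x‖))) :=
        mul_le_mul_of_nonneg_left (add_le_add h1 h6) (by positivity)
    _ = _ := by field_simp; ring

lemma inv_norm_mul_sub_le_two_mul {p : Seminorm ℝ E} {M : ℝ} (hp : ∀ z, p z ≤ M * ‖z‖) {x : E}
    (hx : x ≠ 0) {ε : ℝ} (hε : 0 ≤ ε) (hM : 0 ≤ M) (y : E) :
    ‖x‖⁻¹ * p x - ‖x + ε • y‖⁻¹ * p (x + ε • y) ≤ 2 * M * ε * ‖y‖ * ‖x‖⁻¹ := by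
  have hx' : 0 < ‖x‖ := norm_pos_iff.2 hx
  set z := x + ε • y with hz
  have hqz : ‖z‖⁻¹ * p z * ‖z‖ = p z := by
    rcases eq_or_ne z 0 with h | h
    · simp [h]
    · field_simp
  have hq0 : 0 ≤ ‖z‖⁻¹ * p z := by positivity
  have hqM : ‖z‖⁻¹ * p z ≤ M := by
    rcases eq_or_ne z 0 with h | h
    · simpa [h] using hM
    · rw [inv_mul_le_iff₀ (norm_pos_iff.2 h), mul_comm]; exact hp z
  set Q := ‖z‖⁻¹ * p z
  have hn : ‖ε • y‖ = ε * ‖y‖ := by rw [norm_smul, Real.norm_of_nonneg hε]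
  have h1 : p x - p z ≤ M * (ε * ‖y‖) := by
    have h := (le_abs_self _).trans (abs_sub_map_le_sub p x z)
    have h' := hp (x - z)
    rw [hz, sub_add_cancel_left, norm_neg, hn] at h'
    exact h.trans (by rw [hz, sub_add_cancel_left]; exact h')
  have h2 : ‖z‖ - ‖x‖ ≤ ε * ‖y‖ := by
    have := norm_add_le x (ε • y)
    rw [hn] at this; linarith
  have h6 : Q * (‖z‖ - ‖x‖) ≤ M * (ε * ‖y‖) :=
    (mul_le_mul_of_nonneg_left h2 hq0).trans (mul_le_mul_of_nonneg_right hqM (by positivity))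
  have h7 : ‖x‖⁻¹ * p x - Q = ‖x‖⁻¹ * ((p x - p z) + Q * (‖z‖ - ‖x‖)) := by
    rw [mul_sub, hqz]; field_simp; ring
  rw [h7]
  calc _ ≤ ‖x‖⁻¹ * (M * (ε * ‖y‖) + M * (ε * ‖y‖)) :=
        mul_le_mul_of_nonneg_left (add_le_add h1 h6) (by positivity)
    _ = _ := by ring

/-- The piecewise linear function which is `1` up to `B` and `0` from `B + η` on. -/
noncomputable def ramp (B η t : ℝ) : ℝ := max 0 (min 1 ((B + η - t) / η))

lemma ramp_nonneg (B η t : ℝ) : 0 ≤ ramp B η t := le_max_left _ _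

lemma ramp_le_one (B η t : ℝ) : ramp B η t ≤ 1 := max_le zero_le_one (min_le_left _ _)

lemma ramp_eq_one {B η t : ℝ} (hη : 0 < η) (ht : t ≤ B) : ramp B η t = 1 := by
  have : 1 ≤ (B + η - t) / η := by rw [le_div_iff₀ hη]; linarith
  simp [ramp, this]

lemma ramp_eq_zero {B η t : ℝ} (hη : 0 < η) (ht : B + η ≤ t) : ramp B η t = 0 := by
  have : (B + η - t) / η ≤ 0 := div_nonpos_of_nonpos_of_nonneg (by linarith) hη.le
  rw [ramp, max_eq_left]
  exact (min_le_right _ _).trans this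

lemma measurable_ramp (B η : ℝ) : Measurable (ramp B η) := by
  unfold ramp; fun_prop

lemma ramp_sub_ramp_le {B η : ℝ} (hη : 0 < η) (a b : ℝ) :
    max (ramp B η b - ramp B η a) 0 ≤ max (a - b) 0 / η := by
  refine max_le ?_ (by positivity)
  have h : (B + η - b) / η ≤ (B + η - a) / η + max (a - b) 0 / η := by
    rw [← add_div]
    exact div_le_div_of_nonneg_right (by linarith [le_max_left (a - b) 0]) hη.le
  have h0 : 0 ≤ max (a - b) 0 / η := by positivity
  set c := max (a - b) 0 / η
  unfold ramp
  rw [sub_le_iff_le_add]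
  refine max_le (by linarith [le_max_left 0 (min 1 ((B + η - a) / η))]) ?_
  have h2 : min 1 ((B + η - b) / η) ≤ c + min 1 ((B + η - a) / η) := by
    rcases min_choice 1 ((B + η - a) / η) with h' | h' <;> rw [h']
    · linarith [min_le_left 1 ((B + η - b) / η)]
    · linarith [min_le_right 1 ((B + η - b) / η)]
  linarith [le_max_right 0 (min 1 ((B + η - a) / η))]

lemma ramp_sub_ramp_eq_zero {B η a : ℝ} (hη : 0 < η) (ha : a ≤ B) (b : ℝ) :
    max (ramp B η b - ramp B η a) 0 = 0 := by
  rw [ramp_eq_one hη ha]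
  exact max_eq_right (by linarith [ramp_le_one B η b])

lemma ramp_sub_ramp_le_sq {B η a : ℝ} (hη : 0 < η) (ha : B + 2 * η ≤ a) (b : ℝ) :
    max (ramp B η b - ramp B η a) 0 ≤ (max (a - b) 0 / η) ^ 2 := by
  rw [ramp_eq_zero hη (by linarith : B + η ≤ a)]
  rcases le_total (B + η) b with h | h
  · rw [ramp_eq_zero hη h]; simp; positivity
  · refine (max_le (by linarith [ramp_le_one B η b]) zero_le_one).trans ?_
    rw [one_le_sq_iff₀ (by positivity), le_div_iff₀ hη]
    exact le_max_of_le_left (by linarith)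

end Cone

section ConeIntegral

variable {E : Type*} [NormedAddCommGroup E] [InnerProductSpace ℝ E]

lemma ramp_rotate_sub_le {p : Seminorm ℝ E} {M : ℝ} (hM : 0 ≤ M) (hp : ∀ z, p z ≤ M * ‖z‖)
    {x u : E} (hx : x ≠ 0) (hux : inner ℝ u x = p x) (hu : ∀ z, inner ℝ u z ≤ p z)
    {B η : ℝ} (hη : 0 < η) {c s : ℝ} (hc : 0 < c) (hs : 0 ≤ s) (y : E) :
    max (ramp B η (‖c • x + s • y‖⁻¹ * p (c • x + s • y)) - ramp B η (‖x‖⁻¹ * p x)) 0 ≤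
      {x : E | B < ‖x‖⁻¹ * p x ∧ ‖x‖⁻¹ * p x < B + 2 * η}.indicator (fun x => ‖x‖⁻¹) x *
        (s / c / η * (|inner ℝ u y| + M * |inner ℝ (‖x‖⁻¹ • x) y|)) +
      ((s / c) ^ 2 * M / (2 * η) + 4 * (s / c) ^ 2 * M ^ 2 / η ^ 2) * (‖x‖ ^ 2)⁻¹ * ‖y‖ ^ 2 := by
  have hε : 0 ≤ s / c := by positivity
  have e : ‖c • x + s • y‖⁻¹ * p (c • x + s • y) =
      ‖x + (s / c) • y‖⁻¹ * p (x + (s / c) • y) := by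
    have : c • x + s • y = c • (x + (s / c) • y) := by
      rw [smul_add, smul_smul, mul_div_cancel₀ _ hc.ne']
    rw [this, norm_smul, map_smul_eq_mul, Real.norm_of_nonneg hc.le]
    field_simp
  rw [e]
  set ε := s / c
  have h1 := inv_norm_mul_sub_le hp hx hux hu hε hM y
  have h2 := inv_norm_mul_sub_le_two_mul hp hx hε hM y
  set a := ‖x‖⁻¹ * p x with ha
  set b := ‖x + ε • y‖⁻¹ * p (x + ε • y)
  have hx' : 0 < ‖x‖ := norm_pos_iff.2 hx
  have k1 : 0 ≤ ε ^ 2 * M / (2 * η) * (‖x‖ ^ 2)⁻¹ * ‖y‖ ^ 2 := by positivity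
  have k2 : 0 ≤ 4 * ε ^ 2 * M ^ 2 / η ^ 2 * (‖x‖ ^ 2)⁻¹ * ‖y‖ ^ 2 := by positivity
  by_cases hD : B < a ∧ a < B + 2 * η
  · rw [Set.indicator_of_mem (by exact hD)]
    refine (ramp_sub_ramp_le hη a b).trans ?_
    have h3 : max (a - b) 0 ≤ ‖x‖⁻¹ * (ε * (|inner ℝ u y| + M * |inner ℝ (‖x‖⁻¹ • x) y|)) +
        ε ^ 2 * M / 2 * ‖y‖ ^ 2 * (‖x‖ ^ 2)⁻¹ := max_le h1 (by positivity)
    have h4 := div_le_div_of_nonneg_right h3 hη.le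
    refine h4.trans ?_
    have h5 : (‖x‖⁻¹ * (ε * (|inner ℝ u y| + M * |inner ℝ (‖x‖⁻¹ • x) y|)) +
        ε ^ 2 * M / 2 * ‖y‖ ^ 2 * (‖x‖ ^ 2)⁻¹) / η =
        ‖x‖⁻¹ * (ε / η * (|inner ℝ u y| + M * |inner ℝ (‖x‖⁻¹ • x) y|)) +
        ε ^ 2 * M / (2 * η) * (‖x‖ ^ 2)⁻¹ * ‖y‖ ^ 2 := by field_simp
    rw [h5]
    linarith
  · rw [Set.indicator_of_notMem (by exact hD), zero_mul, zero_add]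
    rw [not_and_or, not_lt, not_lt] at hD
    rcases hD with hD | hD
    · rw [ramp_sub_ramp_eq_zero hη hD]; linarith
    · refine (ramp_sub_ramp_le_sq hη hD b).trans ?_
      have h3 : max (a - b) 0 ≤ 2 * M * ε * ‖y‖ * ‖x‖⁻¹ := max_le h2 (by positivity)
      calc (max (a - b) 0 / η) ^ 2 ≤ (2 * M * ε * ‖y‖ * ‖x‖⁻¹ / η) ^ 2 := by gcongr
        _ = 4 * ε ^ 2 * M ^ 2 / η ^ 2 * (‖x‖ ^ 2)⁻¹ * ‖y‖ ^ 2 := by field_simp; ring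
        _ ≤ _ := by linarith

variable [MeasurableSpace E] [BorelSpace E]

lemma measurable_inv_norm_mul {p : Seminorm ℝ E} {M : ℝ} (hM : 0 ≤ M)
    (hp : ∀ z, p z ≤ M * ‖z‖) : Measurable fun x => ‖x‖⁻¹ * p x :=
  measurable_norm.inv.mul (Seminorm.continuous_of_le_mul_norm hM hp).measurable

variable [FiniteDimensional ℝ E]

lemma integral_ramp_rotate_sub_le {p : Seminorm ℝ E} {M : ℝ} (hM : 0 ≤ M)
    (hp : ∀ z, p z ≤ M * ‖z‖) {x : E} (hx : x ≠ 0) {B η : ℝ} (hη : 0 < η) {c s : ℝ}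
    (hc : 0 < c) (hs : 0 ≤ s) :
    ∫ y, max (ramp B η (‖c • x + s • y‖⁻¹ * p (c • x + s • y)) - ramp B η (‖x‖⁻¹ * p x)) 0
        ∂ProbabilityTheory.stdGaussian E ≤
      {x : E | B < ‖x‖⁻¹ * p x ∧ ‖x‖⁻¹ * p x < B + 2 * η}.indicator (fun x => ‖x‖⁻¹) x *
        (2 * M * (s / c) / η) +
      ((s / c) ^ 2 * M / (2 * η) + 4 * (s / c) ^ 2 * M ^ 2 / η ^ 2) *
        Module.finrank ℝ E * (‖x‖ ^ 2)⁻¹ := by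
  obtain ⟨u, hux, hu⟩ := p.exists_subgradient x
  have huM : ‖u‖ ≤ M := by
    have h := (hu u).trans (hp u)
    rw [real_inner_self_eq_norm_sq] at h
    by_contra! h'
    nlinarith [norm_nonneg u]
  have hθ : ‖‖x‖⁻¹ • x‖ = 1 := by rw [norm_smul, norm_inv, norm_norm, inv_mul_cancel₀ (norm_ne_zero_iff.2 hx)]
  have i1 : ∀ v : E, Integrable (fun y => |inner ℝ v y|) (ProbabilityTheory.stdGaussian E) :=
    fun v => ((memLp_inner_stdGaussian v).integrable (by norm_num)).abs
  have i2 := integrable_sq_norm_stdGaussian (E := E)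
  have i3 : Integrable (fun y => s / c / η * (|inner ℝ u y| + M * |inner ℝ (‖x‖⁻¹ • x) y|))
      (ProbabilityTheory.stdGaussian E) := ((i1 u).add ((i1 (‖x‖⁻¹ • x)).const_mul M)).const_mul (s / c / η)
  set I := {x : E | B < ‖x‖⁻¹ * p x ∧ ‖x‖⁻¹ * p x < B + 2 * η}.indicator (fun x => ‖x‖⁻¹) x
  have hI : 0 ≤ I := Set.indicator_nonneg (fun x _ => by positivity) x
  set K := (s / c) ^ 2 * M / (2 * η) + 4 * (s / c) ^ 2 * M ^ 2 / η ^ 2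
  calc _ ≤ ∫ y, (I * (s / c / η * (|inner ℝ u y| + M * |inner ℝ (‖x‖⁻¹ • x) y|)) +
        K * (‖x‖ ^ 2)⁻¹ * ‖y‖ ^ 2) ∂ProbabilityTheory.stdGaussian E :=
        integral_mono_of_nonneg (Filter.Eventually.of_forall fun y => le_max_right _ _)
          ((i3.const_mul I).add (i2.const_mul _))
          (Filter.Eventually.of_forall fun y => ramp_rotate_sub_le hM hp hx hux hu hη hc hs y)
    _ = I * (s / c / η * (∫ y, |inner ℝ u y| ∂ProbabilityTheory.stdGaussian E +
          M * ∫ y, |inner ℝ (‖x‖⁻¹ • x) y| ∂ProbabilityTheory.stdGaussian E)) +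
        K * (‖x‖ ^ 2)⁻¹ * Module.finrank ℝ E := by
        rw [integral_add (i3.const_mul I) (i2.const_mul _), integral_const_mul, integral_const_mul,
          integral_const_mul, integral_add (i1 u) ((i1 _).const_mul M), integral_const_mul,
          integral_sq_norm_stdGaussian]
    _ ≤ I * (s / c / η * (M + M * 1)) + K * (‖x‖ ^ 2)⁻¹ * Module.finrank ℝ E := by
        have h1 := (integral_abs_inner_le u).trans huM
        have h2 := integral_abs_inner_le (‖x‖⁻¹ • x)
        rw [hθ] at h2
        gcongr
    _ = _ := by ring

lemma integral_indicator_cone_inv_norm_le {p : Seminorm ℝ E} {M : ℝ} (hM : 0 ≤ M)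
    (hp : ∀ z, p z ≤ M * ‖z‖) (hE : 2 < Module.finrank ℝ E) (B A : ℝ) :
    ∫ x, {x : E | B < ‖x‖⁻¹ * p x ∧ ‖x‖⁻¹ * p x < A}.indicator (fun x => ‖x‖⁻¹) x
        ∂ProbabilityTheory.stdGaussian E ≤
      (ProbabilityTheory.stdGaussian E).real {x : E | B < ‖x‖⁻¹ * p x ∧ ‖x‖⁻¹ * p x < A} *
        √(1 / (Module.finrank ℝ E - 2)) := by
  have : Nontrivial E := Module.nontrivial_of_finrank_pos (R := ℝ) (by omega)
  have hpm := (Seminorm.continuous_of_le_mul_norm hM hp).measurable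
  set D := {x : E | B < ‖x‖⁻¹ * p x ∧ ‖x‖⁻¹ * p x < A}
  have hDm : MeasurableSet D :=
    (measurableSet_lt measurable_const (measurable_inv_norm_mul hM hp)).inter
      (measurableSet_lt (measurable_inv_norm_mul hM hp) measurable_const)
  set S := {x : E | B < p x ∧ p x < A}
  have hSm : MeasurableSet S :=
    (measurableSet_lt measurable_const hpm).inter (measurableSet_lt hpm measurable_const)
  have hDS : ∀ x, D.indicator (fun _ => (1 : ℝ)) x = S.indicator (fun _ => (1 : ℝ)) (‖x‖⁻¹ • x) := by
    intro x
    have : x ∈ D ↔ ‖x‖⁻¹ • x ∈ S := by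
      simp only [D, S, Set.mem_ofPred_eq, map_smul_eq_mul, norm_inv, norm_norm]
    by_cases h : x ∈ D
    · rw [Set.indicator_of_mem h, Set.indicator_of_mem (this.1 h)]
    · rw [Set.indicator_of_notMem h, Set.indicator_of_notMem (mt this.2 h)]
  have hφ : Measurable (S.indicator fun _ => (1 : ℝ)) := measurable_const.indicator hSm
  have hind := (indepFun_direction_norm (E := E)).comp hφ (measurable_inv (G := ℝ))
  have e : ∀ x, D.indicator (fun x => ‖x‖⁻¹) x =
      S.indicator (fun _ => (1 : ℝ)) (‖x‖⁻¹ • x) * ‖x‖⁻¹ := by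
    intro x
    rw [← hDS]
    by_cases h : x ∈ D <;> simp [h]
  simp_rw [e]
  have h := hind.integral_fun_mul_eq_mul_integral
    (hφ.comp (by fun_prop)).aestronglyMeasurable (by fun_prop)
  simp only [Function.comp_apply] at h
  rw [h]
  have h2 : ∫ x, S.indicator (fun _ => (1 : ℝ)) (‖x‖⁻¹ • x) ∂ProbabilityTheory.stdGaussian E =
      (ProbabilityTheory.stdGaussian E).real D := by
    simp_rw [← hDS]
    exact integral_indicator_one hDm
  rw [h2]
  exact mul_le_mul_of_nonneg_left (integral_inv_norm_le hE) measureReal_nonneg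

end ConeIntegral

section ConeEstimate

variable {E : Type*} [NormedAddCommGroup E] [InnerProductSpace ℝ E] [FiniteDimensional ℝ E]
  [MeasurableSpace E] [BorelSpace E]

lemma integral_ramp_rotation_le {p : Seminorm ℝ E} {M : ℝ} (hM : 0 ≤ M)
    (hp : ∀ z, p z ≤ M * ‖z‖) (hE : 2 < Module.finrank ℝ E) {B η : ℝ} (hη : 0 < η) {c s : ℝ}
    (hc : 0 < c) (hs : 0 ≤ s) :
    ∫ z, max (ramp B η (‖c • z.1 + s • z.2‖⁻¹ * p (c • z.1 + s • z.2)) -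
        ramp B η (‖z.1‖⁻¹ * p z.1)) 0
        ∂(ProbabilityTheory.stdGaussian E).prod (ProbabilityTheory.stdGaussian E) ≤
      (ProbabilityTheory.stdGaussian E).real
          {x : E | B < ‖x‖⁻¹ * p x ∧ ‖x‖⁻¹ * p x < B + 2 * η} *
        √(1 / (Module.finrank ℝ E - 2)) * (2 * M * (s / c) / η) +
      ((s / c) ^ 2 * M / (2 * η) + 4 * (s / c) ^ 2 * M ^ 2 / η ^ 2) *
        Module.finrank ℝ E * (1 / (Module.finrank ℝ E - 2)) := by
  have : Nontrivial E := Module.nontrivial_of_finrank_pos (R := ℝ) (by omega)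
  have hq := measurable_inv_norm_mul hM hp
  have hr : Measurable fun x => ramp B η (‖x‖⁻¹ * p x) := (measurable_ramp B η).comp hq
  have hm : Measurable fun z : E × E => max (ramp B η (‖c • z.1 + s • z.2‖⁻¹ *
      p (c • z.1 + s • z.2)) - ramp B η (‖z.1‖⁻¹ * p z.1)) 0 :=
    ((hr.comp (by fun_prop : Measurable fun z : E × E => c • z.1 + s • z.2)).sub
      (hr.comp measurable_fst)).max measurable_const
  have hint : Integrable (fun z : E × E => max (ramp B η (‖c • z.1 + s • z.2‖⁻¹ *
      p (c • z.1 + s • z.2)) - ramp B η (‖z.1‖⁻¹ * p z.1)) 0)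
      ((ProbabilityTheory.stdGaussian E).prod (ProbabilityTheory.stdGaussian E)) :=
    .of_bound hm.aestronglyMeasurable 1 (Filter.Eventually.of_forall fun z => by
      rw [Real.norm_of_nonneg (le_max_right _ _)]
      exact max_le (by
        linarith [ramp_le_one B η (‖c • z.1 + s • z.2‖⁻¹ * p (c • z.1 + s • z.2)),
          ramp_nonneg B η (‖z.1‖⁻¹ * p z.1)]) zero_le_one)
  rw [integral_prod _ hint]
  set D := {x : E | B < ‖x‖⁻¹ * p x ∧ ‖x‖⁻¹ * p x < B + 2 * η}
  have hDm : MeasurableSet D :=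
    (measurableSet_lt measurable_const hq).inter (measurableSet_lt hq measurable_const)
  have j1 : Integrable (D.indicator fun x => ‖x‖⁻¹) (ProbabilityTheory.stdGaussian E) :=
    ((memLp_inv_norm hE).integrable (by norm_num)).indicator hDm
  have j2 := integrable_inv_sq_norm hE
  have hne : ∀ᵐ x ∂ProbabilityTheory.stdGaussian E, x ≠ 0 :=
    stdGaussian_absolutelyContinuous.ae_le (Measure.ae_ne volume 0)
  refine (integral_mono_of_nonneg
    (Filter.Eventually.of_forall fun x => integral_nonneg fun y => le_max_right _ _)
    ((j1.mul_const (2 * M * (s / c) / η)).add (j2.const_mul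
      (((s / c) ^ 2 * M / (2 * η) + 4 * (s / c) ^ 2 * M ^ 2 / η ^ 2) * Module.finrank ℝ E)))
    (hne.mono fun x hx => integral_ramp_rotate_sub_le hM hp hx hη hc hs)).trans ?_
  simp only [Pi.add_apply]
  rw [integral_add (j1.mul_const _) (j2.const_mul _), integral_mul_const, integral_const_mul,
    integral_inv_sq_norm hE]
  gcongr
  exact integral_indicator_cone_inv_norm_le hM hp hE B (B + 2 * η)

lemma measureReal_mul_measureReal_le_integral_ramp {p : Seminorm ℝ E} {M : ℝ} (hM : 0 ≤ M)
    (hp : ∀ z, p z ≤ M * ‖z‖) {B η : ℝ} (hη : 0 < η) :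
    (ProbabilityTheory.stdGaussian E).real {x | ‖x‖⁻¹ * p x ≤ B} *
        (ProbabilityTheory.stdGaussian E).real {x | B + 2 * η ≤ ‖x‖⁻¹ * p x} ≤
      ∫ z, |ramp B η (‖z.1‖⁻¹ * p z.1) - ramp B η (‖z.2‖⁻¹ * p z.2)|
        ∂(ProbabilityTheory.stdGaussian E).prod (ProbabilityTheory.stdGaussian E) := by
  have hq := measurable_inv_norm_mul hM hp
  have hr : Measurable fun x => ramp B η (‖x‖⁻¹ * p x) := (measurable_ramp B η).comp hq
  have m1 : MeasurableSet {x | ‖x‖⁻¹ * p x ≤ B} := measurableSet_le hq measurable_const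
  have m2 : MeasurableSet {x | B + 2 * η ≤ ‖x‖⁻¹ * p x} := measurableSet_le measurable_const hq
  rw [← measureReal_prod_prod, ← integral_indicator_one (m1.prod m2)]
  refine integral_mono_of_nonneg
    (Filter.Eventually.of_forall fun z => Set.indicator_nonneg (fun _ _ => zero_le_one) z)
    (.of_bound ((hr.comp measurable_fst).sub (hr.comp measurable_snd)).abs.aestronglyMeasurable 1
      (Filter.Eventually.of_forall fun z => ?_)) (Filter.Eventually.of_forall fun z => ?_)
  · rw [Real.norm_eq_abs, abs_abs, abs_le]
    constructor <;> linarith [ramp_nonneg B η (‖z.1‖⁻¹ * p z.1), ramp_le_one B η (‖z.1‖⁻¹ * p z.1),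
      ramp_nonneg B η (‖z.2‖⁻¹ * p z.2), ramp_le_one B η (‖z.2‖⁻¹ * p z.2)]
  · refine Set.indicator_apply_le' (fun hz => ?_) fun _ => abs_nonneg _
    have h1 : ‖z.1‖⁻¹ * p z.1 ≤ B := hz.1
    have h2 : B + 2 * η ≤ ‖z.2‖⁻¹ * p z.2 := hz.2
    beta_reduce
    rw [ramp_eq_one hη h1, ramp_eq_zero hη (by linarith)]
    simp

/-- If both the cone of directions where `p ≤ B` and the one where `p ≥ A` are large, then
so is the cone in between. -/
lemma measureReal_cone_mul_le {p : Seminorm ℝ E} {M : ℝ} (hM : 0 ≤ M)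
    (hp : ∀ z, p z ≤ M * ‖z‖) (hE : 2 < Module.finrank ℝ E) {B A : ℝ} (hBA : B < A) :
    (ProbabilityTheory.stdGaussian E).real {x | ‖x‖⁻¹ * p x ≤ B} *
        (ProbabilityTheory.stdGaussian E).real {x | A ≤ ‖x‖⁻¹ * p x} ≤
      32 * M / (A - B) *
        (ProbabilityTheory.stdGaussian E).real {x : E | B < ‖x‖⁻¹ * p x ∧ ‖x‖⁻¹ * p x < A} *
        √(1 / (Module.finrank ℝ E - 2)) := by
  obtain ⟨η, rfl⟩ : ∃ η, A = B + 2 * η := ⟨(A - B) / 2, by ring⟩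
  have hη : 0 < η := by linarith
  have hn : (0 : ℝ) < Module.finrank ℝ E - 2 := by
    have : ((2 : ℕ) : ℝ) < Module.finrank ℝ E := by exact_mod_cast hE
    push_cast at this; linarith
  have hr : Measurable fun x => ramp B η (‖x‖⁻¹ * p x) :=
    (measurable_ramp B η).comp (measurable_inv_norm_mul hM hp)
  set d := (ProbabilityTheory.stdGaussian E).real
    {x : E | B < ‖x‖⁻¹ * p x ∧ ‖x‖⁻¹ * p x < B + 2 * η} with hd
  set S := √(1 / ((Module.finrank ℝ E : ℝ) - 2)) with hS
  set K := (M / (2 * η) + 4 * M ^ 2 / η ^ 2) * Module.finrank ℝ E *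
    (1 / (Module.finrank ℝ E - 2)) with hK
  have hK0 : 0 ≤ K := by positivity
  have hd0 : 0 ≤ d := measureReal_nonneg
  have key : ∀ N : ℕ, 2 ≤ N →
      (ProbabilityTheory.stdGaussian E).real {x | ‖x‖⁻¹ * p x ≤ B} *
        (ProbabilityTheory.stdGaussian E).real {x | B + 2 * η ≤ ‖x‖⁻¹ * p x} ≤
      32 * M / (B + 2 * η - B) * d * S + 32 * K / N := by
    intro N hN
    have hN' : (2 : ℝ) ≤ N := by exact_mod_cast hN
    have hτ0 : 0 < Real.pi / (2 * N) := by positivity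
    have hτ1 : Real.pi / (2 * N) ≤ 2 / N := by
      rw [div_le_div_iff₀ (by positivity) (by positivity)]
      nlinarith [Real.pi_le_four]
    have hτ2 : Real.pi / (2 * N) ≤ Real.pi / 3 := by
      apply div_le_div_of_nonneg_left Real.pi_pos.le (by norm_num); linarith
    have hcos : 1 / 2 ≤ Real.cos (Real.pi / (2 * N)) := by
      rw [← Real.cos_pi_div_three]
      exact Real.cos_le_cos_of_nonneg_of_le_pi hτ0.le (by linarith [Real.pi_pos]) hτ2
    have hsin0 : 0 ≤ Real.sin (Real.pi / (2 * N)) :=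
      Real.sin_nonneg_of_nonneg_of_le_pi hτ0.le (by linarith [Real.pi_pos])
    have hsin : Real.sin (Real.pi / (2 * N)) ≤ 2 / N := (Real.sin_le hτ0.le).trans hτ1
    have h1 := measureReal_mul_measureReal_le_integral_ramp hM hp (B := B) hη
    have h2 := integral_abs_sub_le_nat_mul hr (fun x => ramp_nonneg _ _ _)
      (fun x => ramp_le_one _ _ _) (by omega : N ≠ 0)
    rw [integral_abs_sub_rotation_eq hr (fun x => ramp_nonneg _ _ _)
      (fun x => ramp_le_one _ _ _)] at h2
    have h3 := integral_ramp_rotation_le hM hp hE (B := B) hη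
      (by linarith : 0 < Real.cos (Real.pi / (2 * N))) hsin0
    have hε : Real.sin (Real.pi / (2 * N)) / Real.cos (Real.pi / (2 * N)) ≤ 4 / N := by
      rw [div_le_iff₀ (by linarith)]
      calc _ ≤ (4 : ℝ) / N * (1 / 2) := by
            rw [show (4 : ℝ) / N * (1 / 2) = 2 / N by ring]; exact hsin
        _ ≤ _ := by gcongr
    have hε0 : 0 ≤ Real.sin (Real.pi / (2 * N)) / Real.cos (Real.pi / (2 * N)) :=
      div_nonneg hsin0 (by linarith)
    set ε := Real.sin (Real.pi / (2 * N)) / Real.cos (Real.pi / (2 * N))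
    have h4 : d * S * (2 * M * ε / η) + (ε ^ 2 * M / (2 * η) + 4 * ε ^ 2 * M ^ 2 / η ^ 2) *
        Module.finrank ℝ E * (1 / (Module.finrank ℝ E - 2)) ≤
        d * S * (2 * M * (4 / N) / η) + (4 / N) ^ 2 * K := by
      have : (ε ^ 2 * M / (2 * η) + 4 * ε ^ 2 * M ^ 2 / η ^ 2) *
        Module.finrank ℝ E * (1 / (Module.finrank ℝ E - 2)) = ε ^ 2 * K := by
          rw [hK]; ring
      rw [this]
      gcongr
    calc _ ≤ (N : ℝ) * (2 * (d * S * (2 * M * (4 / N) / η) + (4 / N) ^ 2 * K)) :=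
          h1.trans (h2.trans (by gcongr; exact h3.trans h4))
      _ = _ := by field_simp; ring
  have hlim : Filter.Tendsto (fun N : ℕ => 32 * M / (B + 2 * η - B) * d * S + 32 * K / N)
      Filter.atTop (nhds (32 * M / (B + 2 * η - B) * d * S + 0)) :=
    (tendsto_const_div_atTop_nhds_zero_nat _).const_add _
  rw [add_zero] at hlim
  exact ge_of_tendsto hlim (Filter.eventually_atTop.2 ⟨2, key⟩)

end ConeEstimate

section NormCLT

open scoped NNReal Topology

lemma stdGaussian_euclidean_eq_map (n : ℕ) :
    ProbabilityTheory.stdGaussian (EuclideanSpace ℝ (Fin n)) =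
      (Measure.infinitePi fun _ : ℕ => gaussianReal 0 1).map
        fun ω => WithLp.toLp 2 fun i : Fin n => ω i := by
  have h := Measure.map_infinitePi_infinitePi_of_inj (P := fun _ : ℕ => gaussianReal 0 1)
    (f := fun i : Fin n => (i : ℕ)) Fin.val_injective
  rw [← map_pi_eq_stdGaussian, ← Measure.infinitePi_eq_pi, ← h, Measure.map_map (by fun_prop)
    (by fun_prop)]
  rfl

lemma integral_sq_gaussianReal : ∫ x, x ^ 2 ∂gaussianReal 0 1 = 1 := by
  have h := variance_id_gaussianReal (μ := 0) (v := 1)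
  rw [variance_eq_sub (memLp_id_gaussianReal 2)] at h
  simpa using h

lemma memLp_sq_gaussianReal : MemLp (fun x : ℝ => x ^ 2) 2 (gaussianReal 0 1) := by
  have h := (memLp_id_gaussianReal (μ := 0) (v := 1) 4).norm_rpow_div 2
  refine (memLp_congr_norm h.aestronglyMeasurable (by fun_prop) (Filter.Eventually.of_forall ?_)).1
    (h.mono_exponent ?_)
  · intro x; simp
  · rw [ENNReal.le_div_iff_mul_le (by simp) (by simp)]; norm_num

lemma variance_sq_gaussianReal_ne_zero : Var[fun x : ℝ => x ^ 2; gaussianReal 0 1] ≠ 0 := by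
  intro h
  have h1 := ae_eq_integral_of_variance_eq_zero memLp_sq_gaussianReal h
  rw [integral_sq_gaussianReal] at h1
  have h2 := (gaussianReal_absolutelyContinuous' 0 one_ne_zero).ae_le h1
  have hsub : Set.Ioo (2 : ℝ) 3 ⊆ {x : ℝ | x ^ 2 = 1}ᶜ := fun x hx hx' => by
    rw [Set.mem_ofPred_eq] at hx'
    nlinarith [hx.1]
  have h3 : volume (Set.Ioo (2 : ℝ) 3) = 0 := measure_mono_null hsub h2
  norm_num at h3

lemma exists_tendsto_measure_sq_norm : ∃ v : ℝ≥0, v ≠ 0 ∧ ∀ S : Set ℝ, MeasurableSet S →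
    gaussianReal 0 v (frontier S) = 0 →
    Filter.Tendsto (fun n : ℕ => ProbabilityTheory.stdGaussian (EuclideanSpace ℝ (Fin n))
      {x | (√n)⁻¹ * (‖x‖ ^ 2 - n) ∈ S}) Filter.atTop (𝓝 (gaussianReal 0 v S)) := by
  set P := Measure.infinitePi fun _ : ℕ => gaussianReal 0 1
  let X : ℕ → (ℕ → ℝ) → ℝ := fun k ω => ω k ^ 2
  have hev : ∀ k, P.map (fun ω => ω k) = gaussianReal 0 1 := fun k =>
    Measure.infinitePi_map_eval _ k
  have hevm : ∀ k, AEMeasurable (fun ω : ℕ → ℝ => ω k) P := fun k =>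
    (measurable_pi_apply k).aemeasurable
  have hmp : MeasurePreserving (fun ω : ℕ → ℝ => ω 0) P (gaussianReal 0 1) :=
    ⟨by fun_prop, hev 0⟩
  have hid : ∀ k, IdentDistrib (X k) (X 0) P P := fun k =>
    IdentDistrib.comp (u := fun x : ℝ => x ^ 2)
      ⟨hevm k, hevm 0, by rw [hev, hev]⟩ (by fun_prop)
  have hind : iIndepFun X P :=
    iIndepFun_infinitePi (X := fun _ (x : ℝ) => x ^ 2) (fun _ => by fun_prop)
  have hL : MemLp (X 0) 2 P := memLp_sq_gaussianReal.comp_measurePreserving hmp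
  have hvar : Var[X 0; P] = Var[fun x : ℝ => x ^ 2; gaussianReal 0 1] := by
    rw [← hev 0, variance_map (by fun_prop) (hevm 0)]; rfl
  have hmean : P[X 0] = 1 := by
    rw [← integral_sq_gaussianReal, ← hev 0, integral_map (hevm 0) (by fun_prop)]
  refine ⟨Var[X 0; P].toNNReal, ?_, fun S hS hS0 => ?_⟩
  · rw [hvar, Ne, Real.toNNReal_eq_zero, not_le]
    exact lt_of_le_of_ne (variance_nonneg _ _) variance_sq_gaussianReal_ne_zero.symm
  have h := (tendstoInDistribution_inv_sqrt_mul_sum_sub (P := P)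
    (P' := gaussianReal 0 Var[X 0; P].toNNReal) (Y := id) HasLaw.id hL hind hid).tendsto
  have h2 := ProbabilityMeasure.tendsto_measure_of_null_frontier_of_tendsto' h (E := S)
    (by simpa using hS0)
  simp only [ProbabilityMeasure.coe_mk, Measure.map_id] at h2
  refine h2.congr fun n => ?_
  have hT : MeasurableSet {x : EuclideanSpace ℝ (Fin n) | (√n)⁻¹ * (‖x‖ ^ 2 - n) ∈ S} :=
    (by fun_prop : Measurable fun x : EuclideanSpace ℝ (Fin n) => (√n)⁻¹ * (‖x‖ ^ 2 - n)) hS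
  rw [Measure.map_apply (by fun_prop) hS, stdGaussian_euclidean_eq_map, Measure.map_apply (by fun_prop) hT]
  congr 1
  ext ω
  simp only [Set.mem_preimage, Set.mem_ofPred_eq, hmean, mul_one, X,
    EuclideanSpace.real_norm_sq_eq, Finset.sum_range]

lemma exists_gaussianReal_tails (v : ℝ≥0) : ∃ s : ℝ, 0 < s ∧
    (gaussianReal 0 v).real (Set.Iic (-s)) < 1 / 4 ∧ (gaussianReal 0 v).real (Set.Ici s) < 1 / 4 := by
  have hmap : ∀ s : ℝ, (gaussianReal 0 v).real (Set.Ici s) =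
      (gaussianReal 0 v).real (Set.Iic (-s)) := fun s => by
    have h : (gaussianReal 0 v).map (fun x => -x) = gaussianReal 0 v := by
      rw [gaussianReal_map_neg, neg_zero]
    conv_lhs => rw [← h, map_measureReal_apply measurable_neg measurableSet_Ici]
    congr 1
    ext x
    simp
  obtain ⟨s, hs, hs'⟩ := ((Filter.eventually_gt_atTop 0).and
    (((tendsto_cdf_atBot (gaussianReal 0 v)).comp
      Filter.tendsto_neg_atTop_atBot).eventually_lt_const
        (by norm_num : (0 : ℝ) < 1 / 4))).exists
  simp only [Function.comp_apply, cdf_eq_real] at hs'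
  exact ⟨s, hs, hs', (hmap s).trans_lt hs'⟩

/-- The squared norm of a standard Gaussian vector deviates from `n` by a multiple of `√n` with
probability bounded away from `0` and at most `1 / 4`, on both sides. -/
lemma exists_sq_norm_tails : ∃ s c : ℝ, 0 < s ∧ 0 < c ∧ ∀ᶠ n : ℕ in Filter.atTop,
    (c ≤ (ProbabilityTheory.stdGaussian (EuclideanSpace ℝ (Fin n))).real
        {x | ‖x‖ ^ 2 ≤ n - s * √n} ∧
      (ProbabilityTheory.stdGaussian (EuclideanSpace ℝ (Fin n))).real
        {x | ‖x‖ ^ 2 ≤ n - s * √n} ≤ 1 / 4) ∧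
    c ≤ (ProbabilityTheory.stdGaussian (EuclideanSpace ℝ (Fin n))).real
        {x | n + s * √n ≤ ‖x‖ ^ 2} ∧
      (ProbabilityTheory.stdGaussian (EuclideanSpace ℝ (Fin n))).real
        {x | n + s * √n ≤ ‖x‖ ^ 2} ≤ 1 / 4 := by
  obtain ⟨v, hv, hlim⟩ := exists_tendsto_measure_sq_norm
  obtain ⟨s, hs, hs1, hs2⟩ := exists_gaussianReal_tails v
  have hna := nullSingletonClass_gaussianReal (μ := 0) hv
  have key : ∀ (S : Set ℝ) (T : (n : ℕ) → Set (EuclideanSpace ℝ (Fin n))), MeasurableSet S →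
      gaussianReal 0 v (frontier S) = 0 → (gaussianReal 0 v).real S < 1 / 4 → volume S ≠ 0 →
      (∀ n : ℕ, 0 < n → {x : EuclideanSpace ℝ (Fin n) | (√n)⁻¹ * (‖x‖ ^ 2 - n) ∈ S} = T n) →
      ∃ c : ℝ, 0 < c ∧ ∀ᶠ n : ℕ in Filter.atTop,
        c ≤ (ProbabilityTheory.stdGaussian (EuclideanSpace ℝ (Fin n))).real (T n) ∧
        (ProbabilityTheory.stdGaussian (EuclideanSpace ℝ (Fin n))).real (T n) ≤ 1 / 4 := by
    intro S T hSm hS0 hS1 hSv hT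
    have h1 := (ENNReal.tendsto_toReal (measure_ne_top _ _)).comp (hlim S hSm hS0)
    have hpos : 0 < (gaussianReal 0 v).real S :=
      ENNReal.toReal_pos (fun h => hSv (gaussianReal_absolutelyContinuous' 0 hv h))
        (measure_ne_top _ _)
    refine ⟨(gaussianReal 0 v).real S / 2, by positivity, ?_⟩
    filter_upwards [h1.eventually_const_le (half_lt_self hpos), h1.eventually_le_const hS1,
      Filter.eventually_gt_atTop 0] with n hn1 hn2 hn0
    rw [← hT n hn0]
    exact ⟨hn1, hn2⟩
  obtain ⟨c₁, hc₁, h₁⟩ := key (Set.Iic (-s)) (fun n => {x | ‖x‖ ^ 2 ≤ n - s * √n})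
    measurableSet_Iic (by simp) hs1 (by simp) fun n hn => by
      ext x
      have : 0 < √(n : ℝ) := by positivity
      simp only [Set.mem_ofPred_eq, Set.mem_Iic, inv_mul_le_iff₀ this]
      constructor <;> intro h <;> linarith
  obtain ⟨c₂, hc₂, h₂⟩ := key (Set.Ici s) (fun n => {x | n + s * √n ≤ ‖x‖ ^ 2})
    measurableSet_Ici (by simp) hs2 (by simp) fun n hn => by
      ext x
      have : 0 < √(n : ℝ) := by positivity
      simp only [Set.mem_ofPred_eq, Set.mem_Ici, le_inv_mul_iff₀ this]
      constructor <;> intro h <;> linarith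
  refine ⟨s, min c₁ c₂, hs, lt_min hc₁ hc₂, ?_⟩
  filter_upwards [h₁, h₂] with n hn1 hn2
  exact ⟨⟨(min_le_left _ _).trans hn1.1, hn1.2⟩, (min_le_right _ _).trans hn2.1, hn2.2⟩

end NormCLT

section SymmetricConvex

variable {E : Type*} [NormedAddCommGroup E] [InnerProductSpace ℝ E] [FiniteDimensional ℝ E]
  [MeasurableSpace E] [BorelSpace E]

lemma gaussianReal_slab_le (r : ℝ) :
    gaussianReal 0 1 {x : ℝ | |x| ≤ r} ≤ ENNReal.ofReal r := by
  have hset : {x : ℝ | |x| ≤ r} = Set.Icc (-r) r := by ext; simp [abs_le]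
  have hpdf (x : ℝ) : gaussianPDF 0 1 x ≤ ENNReal.ofReal (1 / 2) := by
    refine ENNReal.ofReal_le_ofReal ?_
    have h2 : (2 : ℝ) ≤ √(2 * Real.pi) :=
      Real.le_sqrt_of_sq_le (by nlinarith [Real.pi_gt_three])
    rw [gaussianPDFReal]
    have h1 : Real.exp (-(x - 0) ^ 2 / (2 * ((1 : NNReal) : ℝ))) ≤ 1 :=
      Real.exp_le_one_iff.2 (by
      rw [NNReal.coe_one, mul_one, neg_div]
      exact neg_nonpos.2 (by positivity))
    calc _ ≤ (√(2 * Real.pi * ((1 : NNReal) : ℝ)))⁻¹ * 1 := by gcongr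
      _ ≤ 1 / 2 := by
        rw [NNReal.coe_one, mul_one, mul_one, one_div]
        gcongr
  rw [hset, gaussianReal_apply _ one_ne_zero]
  calc _ ≤ ∫⁻ _ in Set.Icc (-r) r, ENNReal.ofReal (1 / 2) := lintegral_mono hpdf
    _ = ENNReal.ofReal r := by
      rw [setLIntegral_const, Real.volume_Icc, ← ENNReal.ofReal_mul (by norm_num)]
      ring_nf

lemma stdGaussian_slab_le {f : StrongDual ℝ E} (hf : f ≠ 0) (r : ℝ) :
    ProbabilityTheory.stdGaussian E {x | |f x| ≤ r * ‖f‖} ≤ ENNReal.ofReal r := by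
  have hf0 : 0 < ‖f‖ := norm_pos_iff.2 hf
  set g : StrongDual ℝ E := ‖f‖⁻¹ • f with hg
  have hg1 : ‖g‖ = 1 := by rw [hg, norm_smul, norm_inv, norm_norm, inv_mul_cancel₀ hf0.ne']
  have hmap : (ProbabilityTheory.stdGaussian E).map g = gaussianReal 0 1 := by
    rw [IsGaussian.map_eq_gaussianReal, integral_strongDual_stdGaussian,
      variance_dual_stdGaussian, hg1]
    simp
  have hset : {x | |f x| ≤ r * ‖f‖} = g ⁻¹' {x : ℝ | |x| ≤ r} := by
    ext x
    simp only [Set.mem_ofPred_eq, Set.mem_preimage, hg, FunLike.coe_smul, Pi.smul_apply,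
      smul_eq_mul, abs_mul, abs_inv, abs_norm]
    rw [inv_mul_le_iff₀ hf0, mul_comm]
  rw [hset, ← Measure.map_apply g.continuous.measurable
    (measurableSet_le (by fun_prop) measurable_const), hmap]
  exact gaussianReal_slab_le r

lemma stdGaussian_frontier_eq_zero {K : Set E} (hK : Convex ℝ K) :
    ProbabilityTheory.stdGaussian E (frontier K) = 0 :=
  stdGaussian_absolutelyContinuous (hK.addHaar_frontier volume)

lemma ball_subset_of_stdGaussian_gt {K : Set E} (hK : Convex ℝ K) (hs : ∀ x, x ∈ K ↔ -x ∈ K)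
    {r : ℝ} (hv : ENNReal.ofReal r < ProbabilityTheory.stdGaussian E K) :
    Metric.ball 0 r ⊆ K := by
  intro z hz
  by_contra hzK
  have hz' : z ∉ interior K := fun h => hzK (interior_subset h)
  obtain ⟨f, hf⟩ := geometric_hahn_banach_open_point hK.interior isOpen_interior hz'
  have hneg : -K = K := by ext x; simpa using (hs x).symm
  have hint : -interior K = interior K := by
    have h := (Homeomorph.neg E).preimage_interior K
    simp only [Homeomorph.coe_neg, Set.neg_preimage, hneg] at h
    exact h
  have hKi : ProbabilityTheory.stdGaussian E K ≤
      ProbabilityTheory.stdGaussian E (interior K) := by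
    calc _ ≤ ProbabilityTheory.stdGaussian E (interior K ∪ frontier K) :=
          measure_mono (subset_closure.trans (closure_eq_interior_union_frontier K).subset)
      _ ≤ _ := (measure_union_le _ _).trans (by rw [stdGaussian_frontier_eq_zero hK, add_zero])
  have hab : ∀ a ∈ interior K, |f a| < f z := fun a ha => by
    have h := hf (-a) (by rw [← hint]; simpa using ha)
    rw [map_neg] at h
    exact abs_lt.2 ⟨by linarith, hf a ha⟩
  have hne : (interior K).Nonempty := by
    refine nonempty_of_measure_ne_zero (μ := ProbabilityTheory.stdGaussian E) fun h => ?_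
    rw [h] at hKi
    exact absurd (hv.trans_le hKi) not_lt_zero
  obtain ⟨a, ha⟩ := hne
  have hfz : 0 < f z := (abs_nonneg _).trans_lt (hab a ha)
  have hf0 : f ≠ 0 := by rintro rfl; simp at hfz
  have hzr : f z ≤ r * ‖f‖ := by
    calc f z ≤ ‖f‖ * ‖z‖ := (le_abs_self _).trans (f.le_opNorm z)
      _ ≤ r * ‖f‖ := by
        rw [mul_comm]
        gcongr
        exact (mem_ball_zero_iff.1 hz).le
  refine absurd (hKi.trans ((measure_mono fun a ha => ?_).trans (stdGaussian_slab_le hf0 r)))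
    hv.not_ge
  exact (hab a ha).le.trans hzr

lemma exists_seminorm_ae_eq {K : Set E} (hK : Convex ℝ K) (hs : ∀ x, x ∈ K ↔ -x ∈ K)
    {r : ℝ} (hr : 0 < r) (hv : ENNReal.ofReal r < ProbabilityTheory.stdGaussian E K) :
    ∃ p : Seminorm ℝ E, (∀ z, p z ≤ r⁻¹ * ‖z‖) ∧
      K =ᵐ[ProbabilityTheory.stdGaussian E] {x | p x ≤ 1} := by
  have hball := ball_subset_of_stdGaussian_gt hK hs hv
  have hK0 : K ∈ nhds (0 : E) := Filter.mem_of_superset (Metric.ball_mem_nhds 0 hr) hball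
  refine ⟨gaugeSeminorm ((balanced_iff_neg_mem hK).2 fun x hx => (hs x).1 hx) hK
    (absorbent_nhds_zero hK0), fun z => ?_, ?_⟩
  · rw [le_inv_mul_iff₀ hr]
    exact mul_gauge_le_norm hball
  · have hset : {x | gauge K x ≤ 1} = closure K := by
      ext x
      exact gauge_le_one_iff_mem_closure hK hK0
    change K =ᵐ[_] {x | gauge K x ≤ 1}
    rw [hset]
    refine ae_eq_set.2 ⟨by simp [Set.sdiff_eq_empty.2 (subset_closure (s := K))], ?_⟩
    exact measure_mono_null (Set.sdiff_subset_sdiff_right interior_subset)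
      (stdGaussian_frontier_eq_zero hK)

lemma stdGaussian_direction_norm_mem [Nontrivial E] {S : Set (E × ℝ)} (hS : MeasurableSet S) :
    ProbabilityTheory.stdGaussian E {x | (‖x‖⁻¹ • x, ‖x‖) ∈ S} =
      ∫⁻ x, ProbabilityTheory.stdGaussian E {y | (‖x‖⁻¹ • x, ‖y‖) ∈ S}
        ∂ProbabilityTheory.stdGaussian E := by
  have h := lintegral_direction_norm (E := E) (measurable_const.indicator hS :
    Measurable (S.indicator fun _ => (1 : ENNReal)))
  have h1 (g : E → E × ℝ) (hg : Measurable g) :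
      ∫⁻ x, S.indicator (fun _ => (1 : ENNReal)) (g x) ∂ProbabilityTheory.stdGaussian E =
        ProbabilityTheory.stdGaussian E {x | g x ∈ S} :=
    lintegral_indicator_one (hg hS)
  rw [h1 _ (by fun_prop)] at h
  rw [h]
  exact lintegral_congr fun x => h1 _ (by fun_prop)

lemma stdGaussian_slope_add_le {t m a b : ℝ} {C : ENNReal} (ht : 0 ≤ t) (ha : 0 < a) (hb : 0 < b)
    (hm : ProbabilityTheory.stdGaussian E {y | ‖y‖ ≤ m} = 1 / 2)
    (hCa : C ≤ ProbabilityTheory.stdGaussian E {y | ‖y‖ ≤ a})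
    (hCb : C ≤ ProbabilityTheory.stdGaussian E {y | b ≤ ‖y‖}) :
    ProbabilityTheory.stdGaussian E {y | t * ‖y‖ ≤ 1} +
        {t : ℝ | b⁻¹ < t ∧ t < a⁻¹}.indicator (fun _ => C) t ≤
      2 * ProbabilityTheory.stdGaussian E {y | t * ‖y‖ ≤ 1 ∧ ‖y‖ ≤ m} := by
  rcases le_or_gt (t * m) 1 with htm | htm
  · have hset : {y : E | t * ‖y‖ ≤ 1 ∧ ‖y‖ ≤ m} = {y | ‖y‖ ≤ m} := by
      ext y
      exact ⟨fun h => h.2, fun h => ⟨(mul_le_mul_of_nonneg_left h ht).trans htm, h⟩⟩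
    rw [hset, hm, one_div, ENNReal.mul_inv_cancel two_ne_zero ENNReal.ofNat_ne_top]
    by_cases hD : b⁻¹ < t ∧ t < a⁻¹
    · rw [Set.indicator_of_mem (by exact hD)]
      have htb : 1 < t * b := by
        have := mul_lt_mul_of_pos_right hD.1 hb
        rwa [inv_mul_cancel₀ hb.ne'] at this
      calc _ ≤ ProbabilityTheory.stdGaussian E {y | t * ‖y‖ ≤ 1} +
            ProbabilityTheory.stdGaussian E {y | b ≤ ‖y‖} := by gcongr
        _ = ProbabilityTheory.stdGaussian E ({y | t * ‖y‖ ≤ 1} ∪ {y | b ≤ ‖y‖}) := by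
            refine (measure_union ?_ (measurableSet_le measurable_const measurable_norm)).symm
            refine Set.disjoint_left.2 fun y hy hy' => ?_
            have h1 : t * b ≤ t * ‖y‖ := mul_le_mul_of_nonneg_left hy' ht
            have h2 : t * ‖y‖ ≤ 1 := hy
            linarith
        _ ≤ 1 := prob_le_one
    · rw [Set.indicator_of_notMem (by exact hD), add_zero]
      exact prob_le_one
  · have ht0 : 0 < t := ht.lt_of_ne (by rintro rfl; simp at htm; linarith)
    have hset : {y : E | t * ‖y‖ ≤ 1 ∧ ‖y‖ ≤ m} = {y | t * ‖y‖ ≤ 1} := by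
      ext y
      refine ⟨fun h => h.1, fun h => ⟨h, ?_⟩⟩
      exact (lt_of_mul_lt_mul_left (lt_of_le_of_lt h htm) ht).le
    rw [hset, two_mul]
    gcongr
    by_cases hD : b⁻¹ < t ∧ t < a⁻¹
    · rw [Set.indicator_of_mem (by exact hD)]
      refine hCa.trans (measure_mono fun y (hy : ‖y‖ ≤ a) => ?_)
      calc t * ‖y‖ ≤ a⁻¹ * a := mul_le_mul hD.2.le hy (norm_nonneg _) (by positivity)
        _ = 1 := inv_mul_cancel₀ ha.ne'
    · rw [Set.indicator_of_notMem (by exact hD)]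
      exact zero_le

lemma stdGaussian_ball_correlation [Nontrivial E] {p : Seminorm ℝ E} (hp : Continuous p)
    {m a b : ℝ} {C : ENNReal} (ha : 0 < a) (hb : 0 < b)
    (hm : ProbabilityTheory.stdGaussian E {y | ‖y‖ ≤ m} = 1 / 2)
    (hCa : C ≤ ProbabilityTheory.stdGaussian E {y | ‖y‖ ≤ a})
    (hCb : C ≤ ProbabilityTheory.stdGaussian E {y | b ≤ ‖y‖}) :
    ProbabilityTheory.stdGaussian E {x | p x ≤ 1} + C * ProbabilityTheory.stdGaussian E
        {x | b⁻¹ < ‖x‖⁻¹ * p x ∧ ‖x‖⁻¹ * p x < a⁻¹} ≤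
      2 * ProbabilityTheory.stdGaussian E ({x | p x ≤ 1} ∩ {x | ‖x‖ ≤ m}) := by
  have hpm : Measurable p := hp.measurable
  have hdir (x : E) : p (‖x‖⁻¹ • x) = ‖x‖⁻¹ * p x := by
    rw [map_smul_eq_mul, norm_inv, norm_norm]
  have hpx (x : E) : p (‖x‖⁻¹ • x) * ‖x‖ = p x := by
    rw [hdir]
    rcases eq_or_ne x 0 with rfl | hx
    · simp
    · field_simp
  have hD : MeasurableSet {x : E | b⁻¹ < ‖x‖⁻¹ * p x ∧ ‖x‖⁻¹ * p x < a⁻¹} := by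
    rw [Set.ofPred_and]
    exact (measurableSet_lt measurable_const (by fun_prop)).inter
      (measurableSet_lt (by fun_prop) measurable_const)
  have hS₁ : MeasurableSet {z : E × ℝ | p z.1 * z.2 ≤ 1} :=
    measurableSet_le (by fun_prop) measurable_const
  have hS₂ : MeasurableSet {z : E × ℝ | p z.1 * z.2 ≤ 1 ∧ z.2 ≤ m} := by
    rw [Set.ofPred_and]
    exact hS₁.inter (measurableSet_le (by fun_prop) measurable_const)
  have h₁ := stdGaussian_direction_norm_mem hS₁
  have h₂ := stdGaussian_direction_norm_mem hS₂
  simp only [Set.mem_ofPred_eq, hpx] at h₁ h₂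
  rw [h₁, ← Set.ofPred_and, h₂, ← lintegral_indicator_const hD,
    ← lintegral_add_right _ (measurable_const.indicator hD), ← lintegral_const_mul' _ _ (by simp)]
  refine lintegral_mono fun x => ?_
  have h := stdGaussian_slope_add_le (E := E) (apply_nonneg p (‖x‖⁻¹ • x)) ha hb hm hCa hCb
  convert h using 2
  simp only [Set.indicator, Set.mem_ofPred_eq, hdir]

end SymmetricConvex

section WeakLearner

lemma measureReal_iff_eq {Ω : Type*} [MeasurableSpace Ω] {P : Measure Ω} [IsProbabilityMeasure P]
    {S T : Set Ω} (hS : MeasurableSet S) (hT : MeasurableSet T) :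
    P.real {x | x ∈ S ↔ x ∈ T} = 1 - P.real S - P.real T + 2 * P.real (T ∩ S) := by
  have hset : {x | x ∈ S ↔ x ∈ T} = (T ∩ S) ∪ (T ∪ S)ᶜ := by
    ext x
    simp only [Set.mem_ofPred_eq, Set.mem_union, Set.mem_inter_iff, Set.mem_compl_iff]
    tauto
  have hdisj : Disjoint (T ∩ S) (T ∪ S)ᶜ :=
    Set.disjoint_compl_right_iff_subset.2 (Set.inter_subset_left.trans Set.subset_union_left)
  rw [hset, measureReal_union hdisj (hT.union hS).compl,
    probReal_compl_eq_one_sub (hT.union hS)]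
  linarith [measureReal_union_add_inter (μ := P) (s := T) hS]

variable {E : Type*} [NormedAddCommGroup E] [InnerProductSpace ℝ E] [FiniteDimensional ℝ E]
  [MeasurableSpace E] [BorelSpace E]

lemma le_measureReal_ball_iff [Nontrivial E] {p : Seminorm ℝ E} (hp : Continuous p)
    {m a b c : ℝ} (ha : 0 < a) (hb : 0 < b) (hc : 0 ≤ c)
    (hm : ProbabilityTheory.stdGaussian E {y | ‖y‖ ≤ m} = 1 / 2)
    (hca : c ≤ (ProbabilityTheory.stdGaussian E).real {y | ‖y‖ ≤ a})
    (hcb : c ≤ (ProbabilityTheory.stdGaussian E).real {y | b ≤ ‖y‖}) :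
    1 / 2 + c * (ProbabilityTheory.stdGaussian E).real
        {x | b⁻¹ < ‖x‖⁻¹ * p x ∧ ‖x‖⁻¹ * p x < a⁻¹} ≤
      (ProbabilityTheory.stdGaussian E).real {x | ‖x‖ ≤ m ↔ p x ≤ 1} := by
  have h := stdGaussian_ball_correlation hp (C := ENNReal.ofReal c) ha hb hm
    (ENNReal.ofReal_le_of_le_toReal hca) (ENNReal.ofReal_le_of_le_toReal hcb)
  have h' := ENNReal.toReal_mono (by finiteness) h
  rw [ENNReal.toReal_add (by finiteness) (by finiteness), ENNReal.toReal_mul, ENNReal.toReal_mul,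
    ENNReal.toReal_ofReal hc, ENNReal.toReal_ofNat] at h'
  have hm' : (ProbabilityTheory.stdGaussian E).real {y | ‖y‖ ≤ m} = 1 / 2 := by
    rw [measureReal_def, hm]; simp
  have hiff := measureReal_iff_eq (P := ProbabilityTheory.stdGaussian E)
    (measurableSet_le measurable_norm measurable_const : MeasurableSet {y : E | ‖y‖ ≤ m})
    (measurableSet_le hp.measurable measurable_const : MeasurableSet {x | p x ≤ 1})
  simp only [Set.mem_ofPred_eq] at hiff
  rw [hiff, hm']
  simp only [← measureReal_def] at h'
  linarith

lemma measureReal_band_lower {p : Seminorm ℝ E} {M : ℝ} (hM : 0 ≤ M)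
    (hp : ∀ z, p z ≤ M * ‖z‖) (hE : 2 < Module.finrank ℝ E) {a b : ℝ} (ha : 0 < a) (hab : a < b)
    (hv : |(ProbabilityTheory.stdGaussian E).real {x | p x ≤ 1} - 1 / 2| ≤ 1 / 40)
    (hta : (ProbabilityTheory.stdGaussian E).real {x | ‖x‖ ≤ a} ≤ 1 / 4)
    (htb : (ProbabilityTheory.stdGaussian E).real {x | b ≤ ‖x‖} ≤ 1 / 4) :
    1 / 10 ≤ (ProbabilityTheory.stdGaussian E).real
        {x | b⁻¹ < ‖x‖⁻¹ * p x ∧ ‖x‖⁻¹ * p x < a⁻¹} ∨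
      a⁻¹ - b⁻¹ ≤ 2048 * M * (ProbabilityTheory.stdGaussian E).real
        {x | b⁻¹ < ‖x‖⁻¹ * p x ∧ ‖x‖⁻¹ * p x < a⁻¹} * √(1 / (Module.finrank ℝ E - 2)) := by
  have hb : 0 < b := ha.trans hab
  have hBA : b⁻¹ < a⁻¹ := inv_strictAnti₀ ha hab
  have hmain := measureReal_cone_mul_le hM hp hE hBA
  have hpx (x : E) : p x = ‖x‖⁻¹ * p x * ‖x‖ := by
    rcases eq_or_ne x 0 with rfl | hx
    · simp
    · field_simp
  have hpm : MeasurableSet {x | p x ≤ 1} :=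
    measurableSet_le (p.continuous_of_le_mul_norm hM hp).measurable measurable_const
  set γ := ProbabilityTheory.stdGaussian E
  set D := {x : E | b⁻¹ < ‖x‖⁻¹ * p x ∧ ‖x‖⁻¹ * p x < a⁻¹}
  have hlow : γ.real {x | p x ≤ 1} ≤
      γ.real {x | ‖x‖⁻¹ * p x ≤ b⁻¹} + γ.real D + γ.real {x | ‖x‖ ≤ a} := by
    refine (measureReal_mono (s₂ := {x | ‖x‖⁻¹ * p x ≤ b⁻¹} ∪ D ∪ {x | ‖x‖ ≤ a})
      fun x (hx : p x ≤ 1) => ?_).trans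
      ((measureReal_union_le _ _).trans (by gcongr; exact measureReal_union_le _ _))
    rcases le_or_gt (‖x‖⁻¹ * p x) b⁻¹ with h1 | h1
    · exact Or.inl (Or.inl h1)
    rcases lt_or_ge (‖x‖⁻¹ * p x) a⁻¹ with h2 | h2
    · exact Or.inl (Or.inr ⟨h1, h2⟩)
    refine Or.inr ?_
    have h3 : a⁻¹ * ‖x‖ ≤ 1 := (mul_le_mul_of_nonneg_right h2 (norm_nonneg x)).trans (hpx x ▸ hx)
    rwa [inv_mul_le_iff₀ ha, mul_one] at h3
  have hupp : γ.real {x | p x ≤ 1}ᶜ ≤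
      γ.real {x | a⁻¹ ≤ ‖x‖⁻¹ * p x} + γ.real D + γ.real {x | b ≤ ‖x‖} := by
    refine (measureReal_mono (s₂ := {x | a⁻¹ ≤ ‖x‖⁻¹ * p x} ∪ D ∪ {x | b ≤ ‖x‖})
      fun x (hx : ¬ p x ≤ 1) => ?_).trans
      ((measureReal_union_le _ _).trans (by gcongr; exact measureReal_union_le _ _))
    rcases le_or_gt a⁻¹ (‖x‖⁻¹ * p x) with h1 | h1
    · exact Or.inl (Or.inl h1)
    rcases lt_or_ge b⁻¹ (‖x‖⁻¹ * p x) with h2 | h2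
    · exact Or.inl (Or.inr ⟨h2, h1⟩)
    refine Or.inr ?_
    have h3 : 1 ≤ b⁻¹ * ‖x‖ := by
      refine (not_le.1 hx).le.trans ?_
      rw [hpx x]
      exact mul_le_mul_of_nonneg_right h2 (norm_nonneg x)
    rwa [le_inv_mul_iff₀ hb, mul_one] at h3
  rw [probReal_compl_eq_one_sub hpm] at hupp
  obtain ⟨hv1, hv2⟩ := abs_le.1 hv
  rcases le_or_gt (1 / 10) (γ.real D) with hd | hd
  · exact Or.inl hd
  refine Or.inr ?_
  have h1 : 1 / 8 ≤ γ.real {x | ‖x‖⁻¹ * p x ≤ b⁻¹} := by linarith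
  have h2 : 1 / 8 ≤ γ.real {x | a⁻¹ ≤ ‖x‖⁻¹ * p x} := by linarith
  have h3 : (1 / 8 : ℝ) * (1 / 8) ≤
      32 * M / (a⁻¹ - b⁻¹) * γ.real D * √(1 / (Module.finrank ℝ E - 2)) :=
    (mul_le_mul h1 h2 (by norm_num) measureReal_nonneg).trans hmain
  have h4 : 32 * M / (a⁻¹ - b⁻¹) * γ.real D * √(1 / (Module.finrank ℝ E - 2)) =
      (32 * M * γ.real D * √(1 / (Module.finrank ℝ E - 2))) / (a⁻¹ - b⁻¹) := by ring
  rw [h4, le_div_iff₀ (sub_pos.2 hBA)] at h3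
  linarith

lemma div_le_inv_sqrt_sub_inv_sqrt {n s : ℝ} (hn : 0 < n) (hs : 0 < s) (hsn : 2 * s ≤ √n) :
    s / (3 * n) ≤ (√(n - s * √n))⁻¹ - (√(n + s * √n))⁻¹ := by
  set t := √n
  have ht : 0 < t := Real.sqrt_pos.2 hn
  have ht2 : t ^ 2 = n := Real.sq_sqrt hn.le
  have hst : s * t ≤ n / 2 := by nlinarith
  have hpos : 0 < n - s * t := by linarith
  have hpos' : 0 < n + s * t := by positivity
  set a := √(n - s * t)
  set b := √(n + s * t)
  have ha : 0 < a := Real.sqrt_pos.2 hpos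
  have hb : 0 < b := Real.sqrt_pos.2 hpos'
  have ha2 : a ^ 2 = n - s * t := Real.sq_sqrt hpos.le
  have hb2 : b ^ 2 = n + s * t := Real.sq_sqrt hpos'.le
  have hat : a ≤ t := Real.sqrt_le_sqrt (by nlinarith)
  have hbt : b ≤ 2 * t := abs_le_of_sq_le_sq' (by nlinarith) (by positivity) |>.2
  have hdiff : a⁻¹ - b⁻¹ = 2 * s * t / (a * b * (a + b)) := by
    field_simp
    nlinarith
  rw [hdiff, div_le_div_iff₀ (by positivity) (by positivity)]
  have h1 : a * b * (a + b) ≤ t * (2 * t) * (t + 2 * t) := by gcongr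
  calc s * (a * b * (a + b)) ≤ s * (t * (2 * t) * (t + 2 * t)) := by gcongr
    _ = 2 * s * t * (3 * n) := by rw [← ht2]; ring

lemma stdGaussian_eq_stdGaussian_euclideanSpace (n : ℕ) :
    stdGaussian n = ProbabilityTheory.stdGaussian (EuclideanSpace ℝ (Fin n)) :=
  map_pi_eq_stdGaussian

end WeakLearner

/-- If `K` is a centrally symmetric convex set whose Gaussian volume is within
`(1/40)·n^{-1/2}` of `1/2`, then the origin-centered ball of radius `r_median`
agrees with `K` with probability at least `1/2 + c'/√n`. -/
theorem ball_hypothesis_weak_learner_symmetric :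
    ∃ c' : ℝ, 0 < c' ∧ ∃ n₀ : ℕ, ∀ n : ℕ, n₀ ≤ n →
      ∀ K : Set (EuclideanSpace ℝ (Fin n)),
        Convex ℝ K → (∀ x, x ∈ K ↔ -x ∈ K) →
        |gaussVol n K - 1 / 2| ≤ (1 / 40) / Real.sqrt n →
        ∀ rmedian : ℝ, 0 < rmedian →
          stdGaussian n (Metric.closedBall (0 : EuclideanSpace ℝ (Fin n)) rmedian)
            = 1 / 2 →
          1 / 2 + c' / Real.sqrt n ≤
            (stdGaussian n
              {x | (if ‖x‖ ≤ rmedian then (1 : ℝ) else -1) = pmInd K x}).toReal := by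
  obtain ⟨s, c, hs, hc, hev⟩ := exists_sq_norm_tails
  obtain ⟨N, hN⟩ := Filter.eventually_atTop.1 hev
  refine ⟨c * min (1 / 10) (s / 49152), by positivity, max (max N 3) ⌈4 * s ^ 2⌉₊,
    fun n hn K hK hsym hvol m _ hm => ?_⟩
  obtain ⟨⟨hca, hta⟩, hcb, htb⟩ := hN n (by omega)
  have hn3 : 3 ≤ n := by omega
  have hn3' : (3 : ℝ) ≤ n := by exact_mod_cast hn3
  have hn0 : (0 : ℝ) < n := by linarith
  have hsn : 2 * s ≤ √(n : ℝ) := by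
    refine Real.le_sqrt_of_sq_le ?_
    have h := (Nat.le_ceil (4 * s ^ 2)).trans (Nat.cast_le.2 ((le_max_right _ _).trans hn))
    linarith [mul_pow 2 s 2]
  have hsqrt1 : 1 ≤ √(n : ℝ) := Real.one_le_sqrt.2 (by linarith)
  rw [gaussVol] at hvol
  rw [stdGaussian_eq_stdGaussian_euclideanSpace] at hvol hm ⊢
  have hball : Metric.closedBall (0 : EuclideanSpace ℝ (Fin n)) m = {x | ‖x‖ ≤ m} := by
    ext; simp
  rw [hball] at hm
  set γ := ProbabilityTheory.stdGaussian (EuclideanSpace ℝ (Fin n))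
  have hvol' : |γ.real K - 1 / 2| ≤ 1 / 40 :=
    hvol.trans (div_le_self (by norm_num) hsqrt1)
  have hKgt : ENNReal.ofReal (1 / 4) < γ K := by
    rw [ENNReal.ofReal_lt_iff_lt_toReal (by norm_num) (by finiteness)]
    have := (abs_le.1 hvol').1
    rw [measureReal_def] at this
    linarith
  obtain ⟨p, hp, hKp⟩ := exists_seminorm_ae_eq hK hsym (by norm_num) hKgt
  have hM : (0 : ℝ) ≤ (1 / 4)⁻¹ := by norm_num
  have hpc := p.continuous_of_le_mul_norm hM hp
  rw [measureReal_congr hKp] at hvol'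
  have hgap := div_le_inv_sqrt_sub_inv_sqrt hn0 hs hsn
  have hpos : 0 < (n : ℝ) - s * √n := by
    nlinarith [Real.sq_sqrt hn0.le, Real.sqrt_pos.2 hn0]
  have hpos' : 0 < (n : ℝ) + s * √n := by positivity
  have hseta : {x : EuclideanSpace ℝ (Fin n) | ‖x‖ ^ 2 ≤ n - s * √n} =
      {x | ‖x‖ ≤ √(n - s * √n)} := by
    ext x
    exact (Real.le_sqrt (norm_nonneg x) hpos.le).symm
  have hsetb : {x : EuclideanSpace ℝ (Fin n) | n + s * √n ≤ ‖x‖ ^ 2} =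
      {x | √(n + s * √n) ≤ ‖x‖} := by
    ext x
    exact (Real.sqrt_le_left (norm_nonneg x)).symm
  rw [hseta] at hca hta
  rw [hsetb] at hcb htb
  set a := √((n : ℝ) - s * √n)
  set b := √((n : ℝ) + s * √n)
  have ha : 0 < a := Real.sqrt_pos.2 hpos
  have hb : 0 < b := Real.sqrt_pos.2 hpos'
  have hab : a < b := Real.sqrt_lt_sqrt hpos.le (by nlinarith [Real.sqrt_pos.2 hn0])
  have : Nontrivial (EuclideanSpace ℝ (Fin n)) :=
    Module.nontrivial_of_finrank_pos (R := ℝ) (by rw [finrank_euclideanSpace_fin]; omega)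
  have hagree : γ {x | (if ‖x‖ ≤ m then (1 : ℝ) else -1) = pmInd K x} =
      γ {x | ‖x‖ ≤ m ↔ p x ≤ 1} := by
    refine measure_congr ?_
    filter_upwards [hKp] with x hx
    have hx' : (x ∈ K) = (p x ≤ 1) := hx
    change ((if ‖x‖ ≤ m then (1 : ℝ) else -1) = pmInd K x) = (‖x‖ ≤ m ↔ p x ≤ 1)
    rw [pmInd, ← hx']
    by_cases h1 : ‖x‖ ≤ m <;> by_cases h2 : x ∈ K <;> simp [h1, h2] <;> norm_num
  rw [hagree]
  refine le_trans ?_ (le_measureReal_ball_iff hpc ha hb hc.le hm hca hcb)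
  have hband := measureReal_band_lower hM hp (by rw [finrank_euclideanSpace_fin]; omega) ha hab
    hvol' hta htb
  rw [mul_div_assoc]
  gcongr
  rw [div_le_iff₀ (by linarith)]
  rcases hband with h | h
  · refine (min_le_left _ _).trans (h.trans (le_mul_of_one_le_right measureReal_nonneg hsqrt1))
  · refine (min_le_right _ _).trans ?_
    rw [finrank_euclideanSpace_fin] at h
    have hS : √(1 / ((n : ℝ) - 2)) ≤ 2 / √n := by
      refine Real.sqrt_le_iff.2 ⟨by positivity, ?_⟩
      rw [div_pow, Real.sq_sqrt hn0.le, div_le_div_iff₀ (by linarith) hn0]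
      linarith
    have h5 : s / (3 * n) ≤ 2048 * (1 / 4)⁻¹ * γ.real {x | b⁻¹ < ‖x‖⁻¹ * p x ∧
        ‖x‖⁻¹ * p x < a⁻¹} * (2 / √n) :=
      hgap.trans (h.trans (by gcongr))
    have hsq : √(n : ℝ) * √n = n := Real.mul_self_sqrt hn0.le
    have h6 := mul_le_mul_of_nonneg_right h5 hn0.le
    have h7 : s / (3 * n) * n = s / 3 := by field_simp
    have h8 (d : ℝ) : 2048 * (1 / 4)⁻¹ * d * (2 / √(n : ℝ)) * n = 16384 * (d * √n) := by
      nth_rw 2 [← hsq]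
      field_simp
      ring
    rw [h7, h8] at h6
    linarith
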